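/- arXiv:2012.02747 — 2 statements merged into one kernel-verified Lean document; each statement's English description precedes it below -/
import Mathlib

section
/- There exist absolute constants 0 < c < A with the following property. If μ is a finite Radon measure on ℝ and r > 0, then c · r^{−3} · ‖μ * 1_{[−r,r]}‖⁴_{U²(ℝ)} ≤ E(μ, r) ≤ A · r^{−3} · ‖μ * 1_{[−r,r]}‖⁴_{U²(ℝ)}. Moreover, for every λ > 0 there exist constants 0 < c_λ < A_λ depending only on λ such that c_λ · ‖μ * 1_{[−r,r]}‖_{U²(ℝ)} ≤ ‖μ * 1_{[−λr,λr]}‖_{U²(ℝ)} ≤ A_λ · ‖μ * 1_{[−r,r]}‖_{U²(ℝ)}. -/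
open MeasureTheory Set
open scoped ENNReal

/-- The additive energy `E(μ, r)` of a measure `μ` at scale `r`. -/
noncomputable def addEnergy {E : Type*} [NormedAddCommGroup E] [MeasurableSpace E]
    (μ : Measure E) (r : ℝ) : ℝ≥0∞ :=
  (μ.prod (μ.prod (μ.prod μ)))
    {p : E × E × E × E | ‖p.1 + p.2.1 - p.2.2.1 - p.2.2.2‖ ≤ r}

/-- The Gowers `U²(ℝ)` norm of a real function (with respect to Lebesgue measure):
`‖f‖_{U²}⁴ = ∫∫∫ f(x) f(x+h) f(x+k) f(x+h+k) dx dh dk`. -/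
noncomputable def gowersU2 (f : ℝ → ℝ) : ℝ :=
  (∫ x : ℝ, ∫ h : ℝ, ∫ k : ℝ, f x * f (x + h) * f (x + k) * f (x + h + k)) ^ ((1 : ℝ) / 4)

/-- The convolution `μ * 1_{[-r,r]}`, i.e. the function `x ↦ μ([x-r, x+r])`. -/
noncomputable def convInd (μ : Measure ℝ) (r : ℝ) : ℝ → ℝ :=
  fun x => (μ (Set.Icc (x - r) (x + r))).toReal

section IntegerPairs

variable {X : Type*} [MeasurableSpace X] (ρ : Measure X) [SFinite ρ] {g : X → ℤ}

lemma measure_prod_int_eq (hg : Measurable g) :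
    (ρ.prod ρ) {p | g p.2 = g p.1} = ∑' i : ℤ, ρ (g ⁻¹' {i}) * ρ (g ⁻¹' {i}) := by
  have hset : {p : X × X | g p.2 = g p.1} = ⋃ i : ℤ, (g ⁻¹' {i}) ×ˢ (g ⁻¹' {i}) := by
    ext p
    simp
  have hm (i : ℤ) : MeasurableSet (g ⁻¹' {i}) := hg (measurableSet_singleton i)
  rw [hset, measure_iUnion _ fun i => (hm i).prod (hm i)]
  · simp only [Measure.prod_prod]
  · intro i j hij
    refine Set.disjoint_left.2 fun p hp hq => hij ?_
    simp only [mem_prod, mem_preimage, mem_singleton_iff] at hp hq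
    exact hp.1.symm.trans hq.1

lemma measure_prod_int_shift_le (hg : Measurable g) (k : ℤ) :
    (ρ.prod ρ) {p | g p.2 = g p.1 + k} ≤ 2 * (ρ.prod ρ) {p | g p.2 = g p.1} := by
  have hset : {p : X × X | g p.2 = g p.1 + k} =
      ⋃ i : ℤ, (g ⁻¹' {i}) ×ˢ (g ⁻¹' {i + k}) := by
    ext p
    simp
  have hmul (a b : ℝ≥0∞) : a * b ≤ a * a + b * b := by
    rcases le_total a b with h | h
    · exact (mul_le_mul_left h b).trans le_add_self
    · exact (mul_le_mul_right h a).trans le_self_add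
  calc (ρ.prod ρ) {p | g p.2 = g p.1 + k}
      ≤ ∑' i : ℤ, ρ (g ⁻¹' {i}) * ρ (g ⁻¹' {i + k}) := by
        rw [hset]
        simpa only [Measure.prod_prod] using
          measure_iUnion_le (μ := ρ.prod ρ) fun i : ℤ => (g ⁻¹' {i}) ×ˢ (g ⁻¹' {i + k})
    _ ≤ ∑' i : ℤ, (ρ (g ⁻¹' {i}) * ρ (g ⁻¹' {i}) +
          ρ (g ⁻¹' {i + k}) * ρ (g ⁻¹' {i + k})) :=
        ENNReal.tsum_le_tsum fun i => hmul _ _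
    _ = 2 * (ρ.prod ρ) {p | g p.2 = g p.1} := by
        rw [ENNReal.tsum_add, measure_prod_int_eq ρ hg, two_mul]
        congr 1
        exact (Equiv.addRight k).tsum_eq fun i => ρ (g ⁻¹' {i}) * ρ (g ⁻¹' {i})

end IntegerPairs

/-- Pairs of values at distance at most `l * r` are not much more frequent than pairs at
distance at most `r`. -/
lemma measure_prod_abs_sub_le_mul {X : Type*} [MeasurableSpace X] (ρ : Measure X) [SFinite ρ]
    {f : X → ℝ} (hf : Measurable f) (l : ℝ) {r : ℝ} (hr : 0 < r) :
    (ρ.prod ρ) {p | |f p.1 - f p.2| ≤ l * r} ≤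
      ((Finset.Icc (-(⌈l⌉ + 1)) (⌈l⌉ + 1)).card * 2 : ℝ≥0∞) *
        (ρ.prod ρ) {p | |f p.1 - f p.2| ≤ r} := by
  set g : X → ℤ := fun x => ⌊f x / r⌋ with hgdef
  have hg : Measurable g := (hf.div_const r).floor
  have hsub : {p : X × X | |f p.1 - f p.2| ≤ l * r} ⊆
      ⋃ k ∈ Finset.Icc (-(⌈l⌉ + 1)) (⌈l⌉ + 1), {p | g p.2 = g p.1 + k} := by
    intro p hp
    have hp' : |f p.1 / r - f p.2 / r| ≤ l := by
      rw [← sub_div, abs_div, abs_of_pos hr, div_le_iff₀ hr]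
      exact hp
    obtain ⟨h1, h2⟩ := abs_le.1 hp'
    have hl := Int.le_ceil l
    have a1 := Int.floor_le (f p.1 / r)
    have a2 := Int.lt_floor_add_one (f p.1 / r)
    have b1 := Int.floor_le (f p.2 / r)
    have b2 := Int.lt_floor_add_one (f p.2 / r)
    simp only [mem_iUnion, Finset.mem_Icc, mem_ofPred_eq, exists_prop]
    refine ⟨g p.2 - g p.1, ⟨?_, ?_⟩, by ring⟩
    · have : ((-(⌈l⌉ + 1) : ℤ) : ℝ) < ((g p.2 - g p.1 : ℤ) : ℝ) := by
        simp only [hgdef]; push_cast; linarith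
      exact (Int.cast_lt.1 this).le
    · have : ((g p.2 - g p.1 : ℤ) : ℝ) < ((⌈l⌉ + 1 : ℤ) : ℝ) := by
        simp only [hgdef]; push_cast; linarith
      exact (Int.cast_lt.1 this).le
  have hdiag : {p : X × X | g p.2 = g p.1} ⊆ {p | |f p.1 - f p.2| ≤ r} := by
    intro p hp
    have h := Int.abs_sub_lt_one_of_floor_eq_floor (Eq.symm hp : ⌊f p.1 / r⌋ = ⌊f p.2 / r⌋)
    rw [← sub_div, abs_div, abs_of_pos hr, div_lt_one hr] at h
    exact h.le
  calc (ρ.prod ρ) {p | |f p.1 - f p.2| ≤ l * r}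
      ≤ ∑ k ∈ Finset.Icc (-(⌈l⌉ + 1)) (⌈l⌉ + 1), (ρ.prod ρ) {p | g p.2 = g p.1 + k} :=
        (measure_mono hsub).trans (measure_biUnion_finset_le _ _)
    _ ≤ ∑ _k ∈ Finset.Icc (-(⌈l⌉ + 1)) (⌈l⌉ + 1), 2 * (ρ.prod ρ) {p | |f p.1 - f p.2| ≤ r} :=
        Finset.sum_le_sum fun k _ => (measure_prod_int_shift_le ρ hg k).trans
          (mul_le_mul_right (measure_mono hdiag) 2)
    _ = _ := by rw [Finset.sum_const, nsmul_eq_mul, mul_assoc]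

lemma measurableSet_addEnergy (r : ℝ) :
    MeasurableSet {p : ℝ × ℝ × ℝ × ℝ | ‖p.1 + p.2.1 - p.2.2.1 - p.2.2.2‖ ≤ r} :=
  measurableSet_le (by fun_prop) measurable_const

lemma addEnergy_eq_pairs (μ : Measure ℝ) [SFinite μ] (r : ℝ) :
    addEnergy μ r = ((μ.prod μ).prod (μ.prod μ))
      {p | |(p.1.1 + p.1.2) - (p.2.1 + p.2.2)| ≤ r} := by
  rw [addEnergy, ← (measurePreserving_prodAssoc μ μ (μ.prod μ)).measure_preimage
    (measurableSet_addEnergy r).nullMeasurableSet]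
  congr 1
  ext p
  simp [MeasurableEquiv.prodAssoc, sub_sub]

lemma exists_addEnergy_mul_le (l : ℝ) :
    ∃ M : ℝ, 0 ≤ M ∧ ∀ (μ : Measure ℝ) [SFinite μ] (r : ℝ), 0 < r →
      addEnergy μ (l * r) ≤ ENNReal.ofReal M * addEnergy μ r := by
  refine ⟨((Finset.Icc (-(⌈l⌉ + 1)) (⌈l⌉ + 1)).card * 2 : ℕ), by positivity, fun μ _ r hr => ?_⟩
  rw [addEnergy_eq_pairs, addEnergy_eq_pairs, ENNReal.ofReal_natCast]
  push_cast
  exact measure_prod_abs_sub_le_mul (μ.prod μ) (f := fun p => p.1 + p.2) (by fun_prop) l hr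

lemma addEnergy_ne_top (μ : Measure ℝ) [IsFiniteMeasure μ] (r : ℝ) : addEnergy μ r ≠ ∞ :=
  measure_ne_top _ _

lemma measurable_convInd (μ : Measure ℝ) [SFinite μ] (r : ℝ) : Measurable (convInd μ r) := by
  have hS : MeasurableSet ({p : ℝ × ℝ | p.1 - r ≤ p.2} ∩ {p | p.2 ≤ p.1 + r}) :=
    (measurableSet_le (by fun_prop) (by fun_prop)).inter
      (measurableSet_le (by fun_prop) (by fun_prop))
  exact (measurable_measure_prodMk_left (ν := μ) hS).ennreal_toReal

/-- The integrand of `gowersU2`, as a function on the parameter space `(x, h, k)`. -/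
def gowersIntegrand (f : ℝ → ℝ) (z : ℝ × ℝ × ℝ) : ℝ :=
  f z.1 * f (z.1 + z.2.1) * f (z.1 + z.2.2) * f (z.1 + z.2.1 + z.2.2)

/-- The pairs of a parallelogram `(x, h, k)` and a quadruple `(b, c, a, d)` such that each of
`a, b, c, d` is `r`-close to the corresponding vertex of the parallelogram. -/
def closeQuadruples (r : ℝ) : Set ((ℝ × ℝ × ℝ) × (ℝ × ℝ × ℝ × ℝ)) :=
  {q | q.2 ∈ Icc (q.1.1 + q.1.2.1 - r) (q.1.1 + q.1.2.1 + r) ×ˢ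
    Icc (q.1.1 + q.1.2.2 - r) (q.1.1 + q.1.2.2 + r) ×ˢ
    Icc (q.1.1 - r) (q.1.1 + r) ×ˢ
    Icc (q.1.1 + q.1.2.1 + q.1.2.2 - r) (q.1.1 + q.1.2.1 + q.1.2.2 + r)}

lemma measurableSet_closeQuadruples (r : ℝ) : MeasurableSet (closeQuadruples r) := by
  simp only [closeQuadruples, mem_prod, mem_Icc]
  measurability

lemma measure_closeQuadruples_section (μ : Measure ℝ) [IsFiniteMeasure μ] (r : ℝ)
    (z : ℝ × ℝ × ℝ) :
    (μ.prod (μ.prod (μ.prod μ))) (Prod.mk z ⁻¹' closeQuadruples r) =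
      ENNReal.ofReal (gowersIntegrand (convInd μ r) z) := by
  have hsec : Prod.mk z ⁻¹' closeQuadruples r = Icc (z.1 + z.2.1 - r) (z.1 + z.2.1 + r) ×ˢ
      Icc (z.1 + z.2.2 - r) (z.1 + z.2.2 + r) ×ˢ Icc (z.1 - r) (z.1 + r) ×ˢ
      Icc (z.1 + z.2.1 + z.2.2 - r) (z.1 + z.2.1 + z.2.2 + r) := rfl
  have hof (x : ℝ) : ENNReal.ofReal (convInd μ r x) = μ (Icc (x - r) (x + r)) :=
    ENNReal.ofReal_toReal (measure_ne_top _ _)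
  have h0 (x : ℝ) : 0 ≤ convInd μ r x := ENNReal.toReal_nonneg
  have h1 := h0 z.1
  have h2 := h0 (z.1 + z.2.1)
  have h3 := h0 (z.1 + z.2.2)
  rw [hsec, gowersIntegrand, ENNReal.ofReal_mul (by positivity),
    ENNReal.ofReal_mul (by positivity), ENNReal.ofReal_mul h1]
  simp only [hof, Measure.prod_prod]
  ring

/-- Volume of the parallelograms close to a given quadruple, bounded above. -/
lemma volume_closeQuadruples_le {r : ℝ} (hr : 0 < r) (p : ℝ × ℝ × ℝ × ℝ) :
    volume ((fun z => (z, p)) ⁻¹' closeQuadruples r) ≤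
      {p : ℝ × ℝ × ℝ × ℝ | ‖p.1 + p.2.1 - p.2.2.1 - p.2.2.2‖ ≤ 4 * r}.indicator
        (fun _ => ENNReal.ofReal (32 * r ^ 3)) p := by
  obtain ⟨b, c, a, d⟩ := p
  by_cases hp : ‖b + c - a - d‖ ≤ 4 * r
  · rw [indicator_of_mem (by exact hp)]
    have hsub : (fun z => (z, (b, c, a, d))) ⁻¹' closeQuadruples r ⊆
        Icc (a - r) (a + r) ×ˢ Icc (b - a - 2 * r) (b - a + 2 * r) ×ˢ
          Icc (c - a - 2 * r) (c - a + 2 * r) := by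
      rintro ⟨x, h, k⟩ hz
      simp only [closeQuadruples, mem_preimage, mem_ofPred_eq, mem_prod, mem_Icc] at hz ⊢
      refine ⟨⟨?_, ?_⟩, ⟨?_, ?_⟩, ?_, ?_⟩ <;> linarith
    refine (measure_mono hsub).trans_eq ?_
    simp only [Measure.volume_eq_prod, Measure.prod_prod, Real.volume_Icc]
    rw [← ENNReal.ofReal_mul (by linarith), ← ENNReal.ofReal_mul (by linarith)]
    congr 1
    ring
  · rw [indicator_of_notMem (by exact hp), nonpos_iff_eq_zero]
    convert measure_empty (μ := (volume : Measure (ℝ × ℝ × ℝ)))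
    refine eq_empty_of_forall_notMem ?_
    rintro ⟨x, h, k⟩ hz
    simp only [closeQuadruples, mem_preimage, mem_ofPred_eq, mem_prod, mem_Icc] at hz
    refine hp (abs_le.2 ⟨?_, ?_⟩) <;> linarith

/-- Volume of the parallelograms close to a given quadruple, bounded below. -/
lemma le_volume_closeQuadruples {r : ℝ} (hr : 0 < r) (p : ℝ × ℝ × ℝ × ℝ) :
    {p : ℝ × ℝ × ℝ × ℝ | ‖p.1 + p.2.1 - p.2.2.1 - p.2.2.2‖ ≤ r}.indicator
        (fun _ => ENNReal.ofReal (1 / 64 * r ^ 3)) p ≤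
      volume ((fun z => (z, p)) ⁻¹' closeQuadruples r) := by
  obtain ⟨b, c, a, d⟩ := p
  by_cases hp : ‖b + c - a - d‖ ≤ r
  · rw [indicator_of_mem (by exact hp)]
    obtain ⟨hp1, hp2⟩ := abs_le.1 hp
    set t := b + c - a - d with ht
    have hsub : Icc (a - r / 8) (a + r / 8) ×ˢ
        Icc (b - a - t / 4 - r / 8) (b - a - t / 4 + r / 8) ×ˢ
          Icc (c - a - t / 4 - r / 8) (c - a - t / 4 + r / 8) ⊆
        (fun z => (z, (b, c, a, d))) ⁻¹' closeQuadruples r := by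
      rintro ⟨x, h, k⟩ hz
      simp only [closeQuadruples, mem_preimage, mem_ofPred_eq, mem_prod, mem_Icc] at hz ⊢
      refine ⟨⟨?_, ?_⟩, ⟨?_, ?_⟩, ⟨?_, ?_⟩, ?_, ?_⟩ <;> linarith
    refine Eq.trans_le ?_ (measure_mono hsub)
    simp only [Measure.volume_eq_prod, Measure.prod_prod, Real.volume_Icc]
    rw [← ENNReal.ofReal_mul (by linarith), ← ENNReal.ofReal_mul (by linarith)]
    congr 1
    ring
  · rw [indicator_of_notMem (by exact hp)]
    exact zero_le

lemma lintegral_gowersIntegrand (μ : Measure ℝ) [IsFiniteMeasure μ] (r : ℝ) :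
    ∫⁻ z, ENNReal.ofReal (gowersIntegrand (convInd μ r) z) =
      ∫⁻ p, volume ((fun z => (z, p)) ⁻¹' closeQuadruples r)
        ∂(μ.prod (μ.prod (μ.prod μ))) := by
  rw [← Measure.prod_apply_symm (measurableSet_closeQuadruples r),
    Measure.prod_apply (measurableSet_closeQuadruples r)]
  simp only [measure_closeQuadruples_section]

lemma lintegral_gowersIntegrand_le (μ : Measure ℝ) [IsFiniteMeasure μ] {r : ℝ} (hr : 0 < r) :
    ∫⁻ z, ENNReal.ofReal (gowersIntegrand (convInd μ r) z) ≤
      ENNReal.ofReal (32 * r ^ 3) * addEnergy μ (4 * r) := by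
  rw [lintegral_gowersIntegrand, addEnergy,
    ← lintegral_indicator_const (measurableSet_addEnergy (4 * r))]
  exact lintegral_mono (volume_closeQuadruples_le hr)

lemma le_lintegral_gowersIntegrand (μ : Measure ℝ) [IsFiniteMeasure μ] {r : ℝ} (hr : 0 < r) :
    ENNReal.ofReal (1 / 64 * r ^ 3) * addEnergy μ r ≤
      ∫⁻ z, ENNReal.ofReal (gowersIntegrand (convInd μ r) z) := by
  rw [lintegral_gowersIntegrand, addEnergy,
    ← lintegral_indicator_const (measurableSet_addEnergy r)]
  exact lintegral_mono (le_volume_closeQuadruples hr)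

lemma gowersU2_convInd_nonneg_and_pow (μ : Measure ℝ) [IsFiniteMeasure μ] {r : ℝ} (hr : 0 < r) :
    0 ≤ gowersU2 (convInd μ r) ∧ ENNReal.ofReal (gowersU2 (convInd μ r) ^ 4) =
      ∫⁻ z, ENNReal.ofReal (gowersIntegrand (convInd μ r) z) := by
  have hmeas := measurable_convInd μ r
  have hm : Measurable (gowersIntegrand (convInd μ r)) := by
    unfold gowersIntegrand
    fun_prop
  have h0 : 0 ≤ gowersIntegrand (convInd μ r) := fun z => by
    have h (x : ℝ) : 0 ≤ convInd μ r x := ENNReal.toReal_nonneg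
    exact mul_nonneg (mul_nonneg (mul_nonneg (h _) (h _)) (h _)) (h _)
  have hint : Integrable (gowersIntegrand (convInd μ r)) := by
    refine (lintegral_ofReal_ne_top_iff_integrable hm.aestronglyMeasurable
      (Filter.Eventually.of_forall h0)).1 (ne_top_of_le_ne_top ?_
        (lintegral_gowersIntegrand_le μ hr))
    exact ENNReal.mul_ne_top ENNReal.ofReal_ne_top (addEnergy_ne_top μ _)
  have heq : ∫ x : ℝ, ∫ h : ℝ, ∫ k : ℝ, convInd μ r x * convInd μ r (x + h) *
      convInd μ r (x + k) * convInd μ r (x + h + k) =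
      ∫ z, gowersIntegrand (convInd μ r) z := by
    rw [Measure.volume_eq_prod] at hint ⊢
    rw [integral_prod _ hint]
    refine integral_congr_ae ?_
    filter_upwards [hint.prod_right_ae] with x hx
    rw [Measure.volume_eq_prod] at hx ⊢
    rw [integral_prod _ hx]
    rfl
  have hI : 0 ≤ ∫ z, gowersIntegrand (convInd μ r) z := integral_nonneg h0
  rw [gowersU2, heq, ← Real.rpow_natCast, ← Real.rpow_mul hI]
  refine ⟨Real.rpow_nonneg hI _, ?_⟩
  norm_num
  exact ofReal_integral_eq_lintegral_ofReal hint (Filter.Eventually.of_forall h0)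

lemma gowersU2_convInd_nonneg (μ : Measure ℝ) [IsFiniteMeasure μ] {r : ℝ} (hr : 0 < r) :
    0 ≤ gowersU2 (convInd μ r) :=
  (gowersU2_convInd_nonneg_and_pow μ hr).1

lemma ofReal_gowersU2_pow_le (μ : Measure ℝ) [IsFiniteMeasure μ] {r : ℝ} (hr : 0 < r) :
    ENNReal.ofReal (gowersU2 (convInd μ r) ^ 4) ≤
      ENNReal.ofReal (32 * r ^ 3) * addEnergy μ (4 * r) :=
  (gowersU2_convInd_nonneg_and_pow μ hr).2 ▸ lintegral_gowersIntegrand_le μ hr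

lemma le_ofReal_gowersU2_pow (μ : Measure ℝ) [IsFiniteMeasure μ] {r : ℝ} (hr : 0 < r) :
    ENNReal.ofReal (1 / 64 * r ^ 3) * addEnergy μ r ≤
      ENNReal.ofReal (gowersU2 (convInd μ r) ^ 4) :=
  (gowersU2_convInd_nonneg_and_pow μ hr).2 ▸ le_lintegral_gowersIntegrand μ hr

/-- The fourth power of the Gowers norm of `μ * 1_{[-r,r]}` against the energy at any
comparable scale. -/
lemma exists_gowersU2_pow_le (l : ℝ) (hl : 0 < l) :
    ∃ B : ℝ, 1 ≤ B ∧ ∀ (μ : Measure ℝ) [IsFiniteMeasure μ] (r : ℝ), 0 < r →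
      gowersU2 (convInd μ (l * r)) ^ 4 ≤ B * r ^ 3 * (addEnergy μ r).toReal := by
  obtain ⟨M, hM, h⟩ := exists_addEnergy_mul_le (4 * l)
  refine ⟨32 * l ^ 3 * M + 1, le_add_of_nonneg_left (by positivity), fun μ _ r hr => ?_⟩
  have hE := h μ r hr
  have hU := ofReal_gowersU2_pow_le μ (mul_pos hl hr)
  rw [← mul_assoc] at hU
  have key := hU.trans (mul_le_mul_right hE _)
  have key' : gowersU2 (convInd μ (l * r)) ^ 4 ≤
      32 * (l * r) ^ 3 * (M * (addEnergy μ r).toReal) := by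
    rw [← ENNReal.ofReal_toReal (addEnergy_ne_top μ r), ← ENNReal.ofReal_mul hM,
      ← ENNReal.ofReal_mul (by positivity)] at key
    exact (ENNReal.ofReal_le_ofReal_iff (by positivity)).1 key
  have : 0 ≤ r ^ 3 * (addEnergy μ r).toReal := by positivity
  linarith

lemma toReal_addEnergy_le (μ : Measure ℝ) [IsFiniteMeasure μ] {r : ℝ} (hr : 0 < r) :
    r ^ 3 * (addEnergy μ r).toReal ≤ 64 * gowersU2 (convInd μ r) ^ 4 := by
  have key := le_ofReal_gowersU2_pow μ hr
  have hU := gowersU2_convInd_nonneg μ hr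
  rw [← ENNReal.ofReal_toReal (addEnergy_ne_top μ r), ← ENNReal.ofReal_mul (by positivity)] at key
  have := (ENNReal.ofReal_le_ofReal_iff (by positivity)).1 key
  linarith

lemma exists_gowersU2_convInd_mul_le (l : ℝ) (hl : 0 < l) :
    ∃ B : ℝ, 1 ≤ B ∧ ∀ (μ : Measure ℝ) [IsFiniteMeasure μ] (r : ℝ), 0 < r →
      gowersU2 (convInd μ (l * r)) ≤ B * gowersU2 (convInd μ r) := by
  obtain ⟨B, hB, h⟩ := exists_gowersU2_pow_le l hl
  refine ⟨B * 64, by linarith, fun μ _ r hr => ?_⟩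
  have hU := gowersU2_convInd_nonneg μ hr
  refine le_of_pow_le_pow_left₀ (n := 4) (by norm_num) (by positivity) ?_
  calc gowersU2 (convInd μ (l * r)) ^ 4
      ≤ B * (r ^ 3 * (addEnergy μ r).toReal) := by rw [← mul_assoc]; exact h μ r hr
    _ ≤ B * (64 * gowersU2 (convInd μ r) ^ 4) :=
        mul_le_mul_of_nonneg_left (toReal_addEnergy_le μ hr) (by linarith)
    _ = (B * 64) * gowersU2 (convInd μ r) ^ 4 := by ring
    _ ≤ (B * 64) ^ 4 * gowersU2 (convInd μ r) ^ 4 :=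
        mul_le_mul_of_nonneg_right (le_self_pow₀ (by linarith) (by norm_num)) (by positivity)
    _ = (B * 64 * gowersU2 (convInd μ r)) ^ 4 := by ring

/-- **Additive energy and Gowers norms.** For finite Radon measures `μ` on `ℝ` and
`r > 0`, `E(μ,r) ∼ r⁻³ ‖μ * 1_{[-r,r]}‖⁴_{U²}`, and for each `λ > 0`,
`‖μ * 1_{[-λr,λr]}‖_{U²} ∼_λ ‖μ * 1_{[-r,r]}‖_{U²}`, with absolute (resp. `λ`-dependent)
implied constants. -/
theorem energy_gowers_comparison :
    ∃ c A : ℝ, 0 < c ∧ c < A ∧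
      ((∀ (μ : Measure ℝ) [IsFiniteMeasure μ] [IsFiniteMeasureOnCompacts μ] (r : ℝ), 0 < r →
          ENNReal.ofReal (c * r ^ (-3 : ℝ) * gowersU2 (convInd μ r) ^ 4) ≤ addEnergy μ r ∧
          addEnergy μ r ≤
            ENNReal.ofReal (A * r ^ (-3 : ℝ) * gowersU2 (convInd μ r) ^ 4)) ∧
        ∀ lam : ℝ, 0 < lam →
          ∃ clam Alam : ℝ, 0 < clam ∧ clam < Alam ∧
            ∀ (μ : Measure ℝ) [IsFiniteMeasure μ] [IsFiniteMeasureOnCompacts μ] (r : ℝ),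
              0 < r →
              clam * gowersU2 (convInd μ r) ≤ gowersU2 (convInd μ (lam * r)) ∧
              gowersU2 (convInd μ (lam * r)) ≤ Alam * gowersU2 (convInd μ r)) := by
  obtain ⟨B, hB, h⟩ := exists_gowersU2_pow_le 1 one_pos
  have hB' : B⁻¹ ≤ 1 := inv_le_one_of_one_le₀ hB
  have hB0 : 0 < B := by linarith
  refine ⟨B⁻¹, 64, by positivity, by linarith, fun μ _ _ r hr => ?_, fun lam hlam => ?_⟩
  · have hr3 : r ^ (-3 : ℝ) = (r ^ 3)⁻¹ := by
      rw [Real.rpow_neg hr.le]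
      norm_cast
    have h1 := h μ r hr
    rw [one_mul] at h1
    have h2 := toReal_addEnergy_le μ hr
    rw [hr3, ← ENNReal.ofReal_toReal (addEnergy_ne_top μ r)]
    constructor <;> refine ENNReal.ofReal_le_ofReal ?_
    · rw [← mul_inv, inv_mul_le_iff₀ (by positivity)]
      exact h1
    · rw [mul_right_comm, ← div_eq_mul_inv, le_div_iff₀ (by positivity), mul_comm]
      exact h2
  · obtain ⟨A, hA, hup⟩ := exists_gowersU2_convInd_mul_le lam hlam
    obtain ⟨C, hC, hlow⟩ := exists_gowersU2_convInd_mul_le lam⁻¹ (inv_pos.2 hlam)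
    have hC' : C⁻¹ ≤ 1 := inv_le_one_of_one_le₀ hC
    have hC0 : 0 < C := by linarith
    refine ⟨C⁻¹, A + 1, by positivity, by linarith, fun μ _ _ r hr => ⟨?_, ?_⟩⟩
    · have := hlow μ (lam * r) (mul_pos hlam hr)
      rw [inv_mul_cancel_left₀ hlam.ne'] at this
      rwa [inv_mul_le_iff₀ hC0]
    · have hU := gowersU2_convInd_nonneg μ hr
      linarith [hup μ r hr]
end

section
/- There exist absolute constants C₂ > 0 and A > 0 with the following property. Let 0 < δ < 1, C > 1, 0 < α < 1 and 0 < ε ≤ 1/2, and set r₀ := exp(−C₂ · C^{16} · (log(C/ε))² / (ε² · min(δ, 1−δ))). Let X ⊆ [0,1] be a δ-regular set on scales [α, 1] with constant C, and let μ = μ_X be an associated regular measure. Then for every r with α ≤ r ≤ r₀ one has E(μ, r) ≤ A · C⁴ · ε · r₀^δ · E(μ, r/r₀). -/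
open MeasureTheory Metric Set
open scoped ENNReal

/-- `μ` is a regular measure associated to the `δ`-regular set `X` on scales `[α₀, α₁]`
with constant `C`. -/
def IsRegularMeasure {E : Type*} [NormedAddCommGroup E] [MeasurableSpace E]
    (δ α₀ α₁ C : ℝ) (X : Set E) (μ : Measure E) : Prop :=
  (∀ K : Set E, IsCompact K → μ K < ⊤) ∧
  μ Xᶜ = 0 ∧
  (∀ (x : E) (r : ℝ), α₀ ≤ r → r ≤ α₁ →
    μ (closedBall x r) ≤ ENNReal.ofReal (C * r ^ δ)) ∧
  (∀ x ∈ X, ∀ r : ℝ, α₀ ≤ r → r ≤ α₁ →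
    ENNReal.ofReal (C⁻¹ * r ^ δ) ≤ μ (closedBall x r))

/-- The right end of the gap of `X` to the right of `a`, the gap being truncated to length `ρ`. -/
noncomputable def gapEnd (X : Set ℝ) (ρ a : ℝ) : ℝ :=
  sInf (insert (a + ρ) (X ∩ Ioi a))

theorem bddBelow_gap (X : Set ℝ) {ρ : ℝ} (hρ : 0 ≤ ρ) (a : ℝ) :
    a ∈ lowerBounds (insert (a + ρ) (X ∩ Ioi a)) := by
  rintro z (rfl | ⟨-, hz⟩)
  · linarith
  · exact le_of_lt hz

theorem le_gapEnd {X : Set ℝ} {ρ a z : ℝ} (hz : z ≤ a + ρ) (h : ∀ p ∈ X, a < p → z ≤ p) :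
    z ≤ gapEnd X ρ a := by
  refine le_csInf ⟨_, mem_insert _ _⟩ ?_
  rintro p (rfl | ⟨hp, hap⟩)
  · exact hz
  · exact h p hp hap

theorem gapEnd_le_add (X : Set ℝ) {ρ : ℝ} (hρ : 0 ≤ ρ) (a : ℝ) : gapEnd X ρ a ≤ a + ρ :=
  csInf_le ⟨a, bddBelow_gap X hρ a⟩ (mem_insert _ _)

theorem gapEnd_le {X : Set ℝ} {ρ a p : ℝ} (hρ : 0 ≤ ρ) (hp : p ∈ X) (hap : a < p) :
    gapEnd X ρ a ≤ p :=
  csInf_le ⟨a, bddBelow_gap X hρ a⟩ (mem_insert_of_mem _ ⟨hp, hap⟩)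

theorem self_le_gapEnd (X : Set ℝ) {ρ : ℝ} (hρ : 0 ≤ ρ) (a : ℝ) : a ≤ gapEnd X ρ a :=
  le_gapEnd (by linarith) fun _ _ h => h.le

theorem finite_long_gaps {X : Set ℝ} {ρ κ : ℝ} (hX : X ⊆ Icc 0 1) (hρ : 0 ≤ ρ) (hκ : 0 < κ) :
    {a ∈ X | κ ≤ gapEnd X ρ a - a}.Finite := by
  have key : ∀ a ∈ {a ∈ X | κ ≤ gapEnd X ρ a - a}, ∀ b ∈ {a ∈ X | κ ≤ gapEnd X ρ a - a},
      a < b → ⌊a / κ⌋ ≠ ⌊b / κ⌋ := by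
    rintro a ⟨-, ha⟩ b ⟨hb, -⟩ hab
    have h1 := gapEnd_le hρ hb hab
    have h2 : a / κ + 1 ≤ b / κ := by
      rw [div_add_one hκ.ne']
      exact div_le_div_of_nonneg_right (by linarith) hκ.le
    have h3 := Int.floor_mono h2
    rw [Int.floor_add_one] at h3
    omega
  refine Set.Finite.of_injOn (f := fun a : ℝ => ⌊a / κ⌋) (t := Icc 0 ⌊1 / κ⌋) ?_ ?_
    (Set.finite_Icc _ _)
  · rintro a ⟨ha, -⟩
    have := hX ha
    exact ⟨Int.floor_nonneg.2 (div_nonneg this.1 hκ.le),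
      Int.floor_mono (div_le_div_of_nonneg_right this.2 hκ.le)⟩
  · intro a ha b hb hab
    by_contra hne
    rcases lt_or_gt_of_ne hne with h | h
    · exact key a ha b hb h hab
    · exact key b hb a ha h hab.symm

/-- A compact set of reals that is sparse at scale `κ` inside windows of length `ρ` has, in each
such window, gaps of length at least `κ` of large total length, whose left neighbourhoods are
disjoint. -/
theorem exists_separated_gaps {X : Set ℝ} {ρ κ c : ℝ} (hX : X ⊆ Icc 0 1) (hXc : IsClosed X)
    (hρ : 0 < ρ) (hκ : 0 < κ) (hc : 0 ≤ c) (hc' : c ≤ 1 / 12)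
    (hbad : ∀ x ∈ X, volume {z ∈ Icc x (x + ρ) | infDist z X ≤ κ} ≤ ENNReal.ofReal (ρ / 2)) :
    ∃ (A : Finset ℝ) (w : ℝ → ℝ),
      (∀ a ∈ A, a ∈ X ∧ κ ≤ w a ∧ w a ≤ ρ ∧ ∀ p ∈ X, p ≤ a ∨ a + w a ≤ p) ∧
      (∀ a ∈ A, ∀ b ∈ A, a ≠ b → Disjoint (Icc (a - c * w a) a) (Icc (b - c * w b) b)) ∧
      ∀ x ∈ X, ρ / 4 ≤ ∑ a ∈ A with a ∈ Icc x (x + ρ), w a := by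
  classical
  set w : ℝ → ℝ := fun a => gapEnd X ρ a - a with hw
  have hw0 : ∀ a, 0 ≤ w a := fun a => sub_nonneg.2 (self_le_gapEnd X hρ.le a)
  have hwρ : ∀ a, w a ≤ ρ := fun a => by have := gapEnd_le_add X hρ.le a; simp only [hw]; linarith
  have hwle : ∀ a p, p ∈ X → a < p → a + w a ≤ p := fun a p hp h => by
    have := gapEnd_le hρ.le hp h; simp only [hw]; linarith
  set B : Finset ℝ := (finite_long_gaps hX hρ.le hκ).toFinset with hB
  have memB : ∀ a, a ∈ B ↔ a ∈ X ∧ κ ≤ w a := fun a => by simp [hB, hw]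
  set A : Finset ℝ := {a ∈ B | ∀ b ∈ B, a < b → a < b - c * w b} with hA
  refine ⟨A, w, ?_, ?_, ?_⟩
  · intro a ha
    have h := (memB a).1 (Finset.mem_filter.1 ha).1
    refine ⟨h.1, h.2, hwρ a, fun p hp => ?_⟩
    rcases le_or_gt p a with h | h
    · exact Or.inl h
    · exact Or.inr (hwle a p hp h)
  · have key : ∀ a ∈ A, ∀ b ∈ A, a < b →
        Disjoint (Icc (a - c * w a) a) (Icc (b - c * w b) b) := by
      intro a ha b hb hab
      have h := (Finset.mem_filter.1 ha).2 b (Finset.mem_filter.1 hb).1 hab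
      refine Set.disjoint_left.2 fun z hz hz' => ?_
      linarith [hz.2, hz'.1]
    intro a ha b hb hne
    rcases lt_or_gt_of_ne hne with h | h
    · exact key a ha b hb h
    · exact (key b hb a ha h).symm
  · intro x hx
    set D : Finset ℝ := {b ∈ B | b ∈ Icc x (x + 2 * ρ)} with hD
    have hcover : Icc x (x + ρ) ⊆ {z ∈ Icc x (x + ρ) | infDist z X ≤ κ} ∪
        ((⋃ a ∈ ({a ∈ A | a ∈ Icc x (x + ρ)} : Finset ℝ), Icc a (a + w a)) ∪
          ⋃ b ∈ D, Icc (b - c * w b) b) := by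
      intro z hz
      have hcpt : IsCompact (X ∩ Icc x z) := isCompact_Icc.inter_left hXc
      obtain ⟨a, ⟨haX, hax, haz⟩, hamax⟩ :=
        hcpt.exists_isGreatest ⟨x, hx, left_mem_Icc.2 hz.1⟩
      have hza : z ≤ a + w a := by
        have : z ≤ gapEnd X ρ a := by
          refine le_gapEnd (by linarith [hz.2]) fun p hp hap => ?_
          by_contra hpz
          have := hamax ⟨hp, hax.trans hap.le, (not_le.1 hpz).le⟩
          linarith
        simp only [hw]; linarith
      by_cases hκa : κ ≤ w a
      · have haB : a ∈ B := (memB a).2 ⟨haX, hκa⟩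
        by_cases haA : a ∈ A
        · refine Or.inr (Or.inl ?_)
          simp only [mem_iUnion]
          exact ⟨a, Finset.mem_filter.2 ⟨haA, hax, haz.trans hz.2⟩, haz, hza⟩
        · have : ∃ b ∈ B, a < b ∧ b - c * w b ≤ a := by
            by_contra hcon
            push Not at hcon
            exact haA (Finset.mem_filter.2 ⟨haB, hcon⟩)
          obtain ⟨b, hbB, hab, hba⟩ := this
          refine Or.inr (Or.inr ?_)
          simp only [mem_iUnion]
          have h1 := hwle a b ((memB b).1 hbB).1 hab
          have h2 : c * w b ≤ 1 * ρ := mul_le_mul (by linarith) (hwρ b) (hw0 b) zero_le_one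
          exact ⟨b, Finset.mem_filter.2 ⟨hbB, by linarith, by linarith [hz.2]⟩,
            by linarith, by linarith⟩
      · refine Or.inl ⟨hz, ?_⟩
        refine (infDist_le_dist_of_mem haX).trans ?_
        rw [Real.dist_eq, abs_of_nonneg (by linarith)]
        linarith
    have hDsum : ∑ b ∈ D, w b ≤ 3 * ρ := by
      have hdisj : (D : Set ℝ).PairwiseDisjoint fun b => Ioo b (b + w b) := by
        have key : ∀ a ∈ D, ∀ b ∈ D, a < b → Disjoint (Ioo a (a + w a)) (Ioo b (b + w b)) := by
          intro a _ b hb hab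
          have := hwle a b ((memB b).1 (Finset.mem_filter.1 hb).1).1 hab
          refine Set.disjoint_left.2 fun z hz hz' => ?_
          linarith [hz.2, hz'.1]
        intro a ha b hb hne
        rcases lt_or_gt_of_ne hne with h | h
        · exact key a ha b hb h
        · exact (key b hb a ha h).symm
      have h1 : volume (⋃ b ∈ D, Ioo b (b + w b)) ≤ volume (Icc x (x + 3 * ρ)) := by
        refine measure_mono (iUnion₂_subset fun b hb z hz => ?_)
        have := (Finset.mem_filter.1 hb).2
        exact ⟨this.1.trans hz.1.le, by linarith [hz.2, this.2, hwρ b]⟩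
      rw [measure_biUnion_finset hdisj fun _ _ => measurableSet_Ioo] at h1
      simp only [Real.volume_Ioo, Real.volume_Icc, add_sub_cancel_left] at h1
      rw [← ENNReal.ofReal_sum_of_nonneg fun b _ => hw0 b] at h1
      exact (ENNReal.ofReal_le_ofReal_iff (by positivity)).1 h1
    have hvol := (measure_mono hcover).trans ((measure_union_le _ _).trans
      (add_le_add (hbad x hx) ((measure_union_le _ _).trans (add_le_add
        (measure_biUnion_finset_le _ _) (measure_biUnion_finset_le _ _)))))
    simp only [Real.volume_Icc, add_sub_cancel_left, sub_sub_cancel] at hvol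
    rw [← ENNReal.ofReal_sum_of_nonneg fun b _ => hw0 b,
      ← ENNReal.ofReal_sum_of_nonneg fun b _ => mul_nonneg hc (hw0 b),
      ← ENNReal.ofReal_add (Finset.sum_nonneg fun b _ => hw0 b)
        (Finset.sum_nonneg fun b _ => mul_nonneg hc (hw0 b)),
      ← ENNReal.ofReal_add (by positivity) (add_nonneg (Finset.sum_nonneg fun b _ => hw0 b)
        (Finset.sum_nonneg fun b _ => mul_nonneg hc (hw0 b))),
      ENNReal.ofReal_le_ofReal_iff (add_nonneg (by positivity)
        (add_nonneg (Finset.sum_nonneg fun b _ => hw0 b)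
        (Finset.sum_nonneg fun b _ => mul_nonneg hc (hw0 b)))), ← Finset.mul_sum] at hvol
    have : c * ∑ b ∈ D, w b ≤ 1 / 12 * (3 * ρ) :=
      mul_le_mul hc' hDsum (Finset.sum_nonneg fun b _ => hw0 b) (by norm_num)
    linarith

open Classical in
/-- The indicator of a proposition, with values in `ℝ≥0∞`. -/
noncomputable def ind (p : Prop) : ℝ≥0∞ := if p then 1 else 0

theorem ind_of {p : Prop} (h : p) : ind p = 1 := if_pos h

theorem ind_of_not {p : Prop} (h : ¬p) : ind p = 0 := if_neg h

theorem ind_mono {p q : Prop} (h : p → q) : ind p ≤ ind q := by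
  by_cases hp : p
  · rw [ind_of hp, ind_of (h hp)]
  · rw [ind_of_not hp]; exact zero_le

theorem ind_le {p : Prop} {t : ℝ≥0∞} (h : p → 1 ≤ t) : ind p ≤ t := by
  by_cases hp : p
  · rw [ind_of hp]; exact h hp
  · rw [ind_of_not hp]; exact zero_le

theorem measurable_ind {β : Type*} [MeasurableSpace β] {p : β → Prop}
    (h : MeasurableSet {x | p x}) : Measurable fun x => ind (p x) := by
  classical
  have : (fun x => ind (p x)) = {x | p x}.indicator 1 := by
    ext x
    by_cases hx : p x <;> simp [ind, hx]
  rw [this]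
  exact measurable_one.indicator h

theorem lintegral_ind {β : Type*} [MeasurableSpace β] {μ : Measure β} {p : β → Prop}
    (h : MeasurableSet {x | p x}) : ∫⁻ x, ind (p x) ∂μ = μ {x | p x} := by
  classical
  have : (fun x => ind (p x)) = {x | p x}.indicator 1 := by
    ext x
    by_cases hx : p x <;> simp [ind, hx]
  rw [this, lintegral_indicator_one h]

theorem ENNReal.le_ofReal_div_mul {a b : ℝ} {s t : ℝ≥0∞} (ha : 0 < a)
    (h : ENNReal.ofReal a * t ≤ ENNReal.ofReal b * s) : t ≤ ENNReal.ofReal (b / a) * s := by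
  rw [ENNReal.ofReal_div_of_pos ha, ← ENNReal.mul_div_right_comm, ENNReal.le_div_iff_mul_le
    (Or.inl (by simpa using ha)) (Or.inl ENNReal.ofReal_ne_top), mul_comm]
  exact h

theorem exists_mem_dist_le {X : Set ℝ} {t s : ℝ} (hXc : IsClosed X) (hne : X.Nonempty)
    (h : infDist t X ≤ s) : ∃ p ∈ X, |t - p| ≤ s := by
  obtain ⟨p, hp, hpt⟩ := hXc.exists_infDist_eq_dist hne t
  exact ⟨p, hp, by rw [← Real.dist_eq, ← hpt]; exact h⟩

theorem measurable_infDist_comp {β : Type*} [MeasurableSpace β] (X : Set ℝ) {f : β → ℝ}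
    (hf : Measurable f) : Measurable fun b => infDist (f b) X :=
  (continuous_infDist_pt X).measurable.comp hf

theorem volume_infDist_le {X : Set ℝ} {μ : Measure ℝ} [IsFiniteMeasure μ] {δ α C ρ κ : ℝ}
    (hδ : δ < 1) (hC : 1 < C) (hα : 0 < α) (hXc : IsClosed X)
    (hU : ∀ x r : ℝ, α ≤ r → r ≤ 1 → μ (closedBall x r) ≤ ENNReal.ofReal (C * r ^ δ))
    (hL : ∀ x ∈ X, ∀ r : ℝ, α ≤ r → r ≤ 1 →
      ENNReal.ofReal (C⁻¹ * r ^ δ) ≤ μ (closedBall x r))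
    (hακ : α ≤ κ) (hκρ : 2 * κ ≤ ρ) (hρ : 2 * ρ ≤ 1)
    (hK : 16 * C ^ 2 * κ ^ (1 - δ) ≤ ρ ^ (1 - δ)) {x : ℝ} (hx : x ∈ X) :
    volume {z ∈ Icc x (x + ρ) | infDist z X ≤ κ} ≤ ENNReal.ofReal (ρ / 2) := by
  have hκ : 0 < κ := hα.trans_le hακ
  have hρ0 : 0 < ρ := by linarith
  set S := {z ∈ Icc x (x + ρ) | infDist z X ≤ κ} with hS
  have hSm : MeasurableSet S :=
    measurableSet_Icc.inter (measurableSet_le (measurable_infDist_comp X measurable_id)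
      measurable_const)
  have hm : Measurable (Function.uncurry fun z p : ℝ => ind (z ∈ S ∧ |p - z| ≤ 2 * κ)) := by
    refine measurable_ind (p := fun q : ℝ × ℝ => q.1 ∈ S ∧ |q.2 - q.1| ≤ 2 * κ) ?_
    exact (measurable_fst hSm).inter (measurableSet_le (f := fun q : ℝ × ℝ => |q.2 - q.1|)
      (by fun_prop) (by fun_prop))
  have h1 : ENNReal.ofReal (C⁻¹ * κ ^ δ) * volume S ≤
      ∫⁻ z, ∫⁻ p, ind (z ∈ S ∧ |p - z| ≤ 2 * κ) ∂μ := by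
    have hvol : volume S = ∫⁻ z, ind (z ∈ S) := (lintegral_ind (p := fun z => z ∈ S) hSm).symm
    rw [hvol,
      ← lintegral_const_mul _ (measurable_ind (p := fun z => z ∈ S) hSm)]
    refine lintegral_mono fun z => ?_
    by_cases hz : z ∈ S
    · obtain ⟨q, hq, hzq⟩ := exists_mem_dist_le hXc ⟨x, hx⟩ hz.2
      simp only [hz, true_and, ind_of trivial, mul_one]
      refine (hL q hq κ hακ (by linarith)).trans ?_
      rw [lintegral_ind (measurableSet_le (by fun_prop) (by fun_prop))]
      refine measure_mono fun p hp => ?_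
      rw [mem_closedBall, Real.dist_eq] at hp
      have hp' := abs_le.1 hp
      have hzq' := abs_le.1 hzq
      change |p - z| ≤ 2 * κ
      refine abs_le.2 ⟨?_, ?_⟩ <;> linarith [hp'.1, hp'.2, hzq'.1, hzq'.2]
    · simp [ind_of_not hz]
  have h2 : ∫⁻ z, ∫⁻ p, ind (z ∈ S ∧ |p - z| ≤ 2 * κ) ∂μ ≤
      ENNReal.ofReal (4 * κ) * ENNReal.ofReal (C * (2 * ρ) ^ δ) := by
    rw [lintegral_lintegral_swap hm.aemeasurable]
    calc ∫⁻ p, (∫⁻ z, ind (z ∈ S ∧ |p - z| ≤ 2 * κ)) ∂μ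
        ≤ ∫⁻ p, ENNReal.ofReal (4 * κ) * ind (p ∈ closedBall x (2 * ρ)) ∂μ := by
          refine lintegral_mono fun p => ?_
          by_cases hp : p ∈ closedBall x (2 * ρ)
          · rw [ind_of hp, mul_one]
            calc ∫⁻ z, ind (z ∈ S ∧ |p - z| ≤ 2 * κ)
                ≤ ∫⁻ z, ind (z ∈ closedBall p (2 * κ)) := by
                  refine lintegral_mono fun z => ind_mono fun h => ?_
                  rw [mem_closedBall, Real.dist_eq, abs_sub_comm]
                  exact h.2
              _ = ENNReal.ofReal (4 * κ) := by
                  rw [lintegral_ind (p := fun z => z ∈ closedBall p (2 * κ))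
                    measurableSet_closedBall]
                  change volume (closedBall p (2 * κ)) = _
                  rw [Real.volume_closedBall]
                  ring_nf
          · refine le_of_eq_of_le ?_ zero_le
            rw [← lintegral_zero (μ := (volume : Measure ℝ))]
            congr 1 with z
            refine ind_of_not fun h => hp ?_
            have h1 := abs_le.1 h.2
            have h2 := h.1.1
            rw [mem_closedBall, Real.dist_eq, abs_le]
            constructor <;> linarith [h1.1, h1.2, h2.1, h2.2]
      _ = ENNReal.ofReal (4 * κ) * μ (closedBall x (2 * ρ)) := by
          rw [lintegral_const_mul _ (measurable_ind (p := fun z => z ∈ closedBall x (2 * ρ))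
            measurableSet_closedBall), lintegral_ind (p := fun z => z ∈ closedBall x (2 * ρ))
            measurableSet_closedBall]
          rfl
      _ ≤ _ := by gcongr; exact hU x _ (by linarith) hρ
  rw [← ENNReal.ofReal_mul (by positivity)] at h2
  have h3 := ENNReal.le_ofReal_div_mul (s := 1) (by positivity)
    ((h1.trans h2).trans_eq (mul_one _).symm)
  rw [mul_one] at h3
  refine h3.trans (ENNReal.ofReal_le_ofReal ?_)
  have e1 : κ ^ (1 - δ) * κ ^ δ = κ := by
    rw [← Real.rpow_add hκ]; simp
  have e2 : ρ ^ (1 - δ) * ρ ^ δ = ρ := by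
    rw [← Real.rpow_add hρ0]; simp
  have e3 : (2 * ρ) ^ δ ≤ 2 * ρ ^ δ := by
    rw [Real.mul_rpow (by norm_num) hρ0.le]
    gcongr
    simpa using Real.rpow_le_rpow_of_exponent_le (x := 2) (by norm_num) hδ.le
  rw [div_le_iff₀ (by positivity)]
  calc 4 * κ * (C * (2 * ρ) ^ δ) ≤ 4 * κ * (C * (2 * ρ ^ δ)) := by gcongr
    _ = (16 * C ^ 2 * κ ^ (1 - δ)) * ρ ^ δ / 2 * (C⁻¹ * κ ^ δ) := by
        conv_lhs => rw [← e1]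
        field_simp
        ring
    _ ≤ ρ ^ (1 - δ) * ρ ^ δ / 2 * (C⁻¹ * κ ^ δ) := by gcongr
    _ = ρ / 2 * (C⁻¹ * κ ^ δ) := by rw [e2]

theorem infDist_of_mem_gap {X : Set ℝ} {ρ σ c a w x h z : ℝ} (ha : a ∈ X)
    (hgap : ∀ p ∈ X, p ≤ a ∨ a + w ≤ p) (hσ : 0 < σ) (hσw : 4 * σ ≤ c * w) (hc' : c ≤ 1 / 12)
    (hw : 0 < w) (hwρ : w ≤ ρ) (hx : x ∈ Icc (a - c * w) a) (hh : h ∈ Ioc (2 * c * w) (w / 2))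
    (hz : |z - (x + h)| ≤ 2 * σ) :
    (σ < infDist z X ∧ infDist z X ≤ 4 * ρ) ∧ z ∈ Ioo a (a + w) := by
  have hz' := abs_le.1 hz
  have hcw : c * w ≤ 1 / 12 * w := by gcongr
  have h1 : a + 2 * σ < z := by nlinarith [hx.1, hh.1, hz'.1]
  have h2 : z ≤ a + w / 2 + 2 * σ := by linarith [hx.2, hh.2, hz'.2]
  refine ⟨⟨?_, ?_⟩, by linarith, by linarith⟩
  · refine lt_of_lt_of_le (by linarith : σ < 2 * σ) ((le_infDist ⟨a, ha⟩).2 fun p hp => ?_)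
    rw [Real.dist_eq]
    rcases hgap p hp with h | h
    · exact le_trans (by linarith) (le_abs_self _)
    · exact le_trans (by linarith) (neg_le_abs _)
  · refine (infDist_le_dist_of_mem ha).trans ?_
    rw [Real.dist_eq, abs_of_nonneg (by linarith)]
    linarith

theorem lintegral_ind_sub_le {μ : Measure ℝ} {b c r : ℝ} {p : ℝ → Prop}
    (hp : MeasurableSet {x | p x}) (h : ∀ x, p x → |x - c| ≤ r)
    (hU : μ (closedBall c r) ≤ ENNReal.ofReal b) : ∫⁻ x, ind (p x) ∂μ ≤ ENNReal.ofReal b := by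
  rw [lintegral_ind hp]
  refine (measure_mono fun x hx => ?_).trans hU
  rw [mem_closedBall, Real.dist_eq]
  exact h x hx

section GapEnergy

variable {X : Set ℝ} {μ : Measure ℝ} [IsFiniteMeasure μ] {δ α C ρ σ c a w : ℝ}

theorem shifted_gap_mass_le (hα : 0 < α) (hXc : IsClosed X)
    (hU : ∀ x r : ℝ, α ≤ r → r ≤ 1 → μ (closedBall x r) ≤ ENNReal.ofReal (C * r ^ δ))
    (hL : ∀ x ∈ X, ∀ r : ℝ, α ≤ r → r ≤ 1 →
      ENNReal.ofReal (C⁻¹ * r ^ δ) ≤ μ (closedBall x r))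
    (hασ : α ≤ σ) (hσw : 4 * σ ≤ c * w) (hc' : c ≤ 1 / 12) (hw : 0 < w) (hwρ : w ≤ ρ)
    (hρ : 2 * ρ ≤ 1) (ha : a ∈ X) (hgap : ∀ p ∈ X, p ≤ a ∨ a + w ≤ p) (y lo hi : ℝ)
    (hD : hi - lo ∈ Ioc (2 * c * w) (w / 2)) :
    ENNReal.ofReal (C⁻¹ * σ ^ δ) *
      (∫⁻ x, ind (x ∈ Icc (a - c * w) a ∧ infDist (x + y - lo) X ≤ σ) ∂μ) ≤
    ENNReal.ofReal (C * (2 * σ) ^ δ) *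
      ∫⁻ q, ind (hi + q - y ∈ Ioo a (a + w) ∧
        (σ < infDist (hi + q - y) X ∧ infDist (hi + q - y) X ≤ 4 * ρ)) ∂μ := by
  have hσ : 0 < σ := hα.trans_le hασ
  have hcw : c * w ≤ 1 / 12 * w := by gcongr
  have hF : MeasurableSet {q : ℝ | hi + q - y ∈ Ioo a (a + w) ∧
      (σ < infDist (hi + q - y) X ∧ infDist (hi + q - y) X ≤ 4 * ρ)} := by
    have hd : Measurable fun q => infDist (hi + q - y) X :=
      measurable_infDist_comp X (by fun_prop)
    have hm : Measurable fun q : ℝ => hi + q - y := by fun_prop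
    exact (hm measurableSet_Ioo).inter
      ((measurableSet_lt measurable_const hd).inter (measurableSet_le hd measurable_const))
  have hS : MeasurableSet {x : ℝ | x ∈ Icc (a - c * w) a ∧ infDist (x + y - lo) X ≤ σ} :=
    measurableSet_Icc.inter (measurableSet_le
      (measurable_infDist_comp X (by fun_prop)) measurable_const)
  have hB : Measurable (fun z : ℝ × ℝ => ind (|z.1 - (z.2 + lo - y)| ≤ 2 * σ)) :=
    measurable_ind (p := fun z : ℝ × ℝ => |z.1 - (z.2 + lo - y)| ≤ 2 * σ)
      (measurableSet_le (f := fun z : ℝ × ℝ => |z.1 - (z.2 + lo - y)|) (by fun_prop) (by fun_prop))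
  set F : ℝ → ℝ≥0∞ := fun q => ind (hi + q - y ∈ Ioo a (a + w) ∧
        (σ < infDist (hi + q - y) X ∧ infDist (hi + q - y) X ≤ 4 * ρ)) with hFdef
  have hFm : Measurable F := measurable_ind hF
  rw [← lintegral_const_mul _ (measurable_ind hS)]
  calc ∫⁻ x, ENNReal.ofReal (C⁻¹ * σ ^ δ) *
        ind (x ∈ Icc (a - c * w) a ∧ infDist (x + y - lo) X ≤ σ) ∂μ
      ≤ ∫⁻ x, ∫⁻ q, F q * ind (|x - (q + lo - y)| ≤ 2 * σ) ∂μ ∂μ := by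
        refine lintegral_mono fun x => ?_
        by_cases hx : x ∈ Icc (a - c * w) a ∧ infDist (x + y - lo) X ≤ σ
        · obtain ⟨q₀, hq₀, hxq⟩ := exists_mem_dist_le hXc ⟨a, ha⟩ hx.2
          rw [ind_of hx, mul_one]
          refine (hL q₀ hq₀ σ hασ (by linarith)).trans ?_
          rw [← lintegral_indicator_one measurableSet_closedBall]
          refine lintegral_mono fun q => ?_
          by_cases hq : q ∈ closedBall q₀ σ
          · rw [indicator_of_mem hq]
            rw [mem_closedBall, Real.dist_eq] at hq
            have h1 := abs_le.1 hq
            have h2 := abs_le.1 hxq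
            have h3 : |x - (q + lo - y)| ≤ 2 * σ := by
              refine abs_le.2 ⟨?_, ?_⟩ <;> linarith [h1.1, h1.2, h2.1, h2.2]
            have h4 : |hi + q - y - (x + (hi - lo))| ≤ 2 * σ := by
              rw [abs_sub_comm]
              convert h3 using 2
              ring
            obtain ⟨h5, h6⟩ :=
              infDist_of_mem_gap ha hgap hσ hσw hc' hw hwρ hx.1 hD h4
            rw [hFdef]
            simp only [ind_of h3, ind_of (And.intro h6 h5), mul_one, Pi.one_apply, le_refl]
          · rw [indicator_of_notMem hq]
            exact zero_le
        · rw [ind_of_not hx, mul_zero]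
          exact zero_le
    _ = ∫⁻ q, ∫⁻ x, F q * ind (|x - (q + lo - y)| ≤ 2 * σ) ∂μ ∂μ :=
        lintegral_lintegral_swap ((hFm.comp measurable_snd).mul hB).aemeasurable
    _ ≤ ∫⁻ q, F q * ENNReal.ofReal (C * (2 * σ) ^ δ) ∂μ := by
        refine lintegral_mono fun q => ?_
        have hm : Measurable fun x : ℝ => ind (|x - (q + lo - y)| ≤ 2 * σ) :=
          hB.comp (measurable_id.prodMk measurable_const)
        rw [lintegral_const_mul _ hm]
        gcongr
        exact lintegral_ind_sub_le (measurableSet_le (by fun_prop) (by fun_prop))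
          (fun x hx => hx) (hU _ _ (by linarith) (by linarith))
    _ = _ := by rw [lintegral_mul_const _ hFm, mul_comm]

/-- Triples `(lo, hi, x)` with `x` next to a gap of `X`, `hi - lo` comparable to the gap length and
`x + y - lo` near `X` are controlled by those for which one of `x + y - lo`, `v + q - y` is near
`X` but not too near. -/
theorem gap_energy_le (hC : 1 < C) (hα : 0 < α) (hXc : IsClosed X) (hδ : 0 < δ)
    (hU : ∀ x r : ℝ, α ≤ r → r ≤ 1 → μ (closedBall x r) ≤ ENNReal.ofReal (C * r ^ δ))
    (hL : ∀ x ∈ X, ∀ r : ℝ, α ≤ r → r ≤ 1 →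
      ENNReal.ofReal (C⁻¹ * r ^ δ) ≤ μ (closedBall x r))
    (hασ : α ≤ σ) (hσw : 4 * σ ≤ c * w) (hc' : c ≤ 1 / 12) (hw : 0 < w) (hwρ : w ≤ ρ)
    (hρ : 2 * ρ ≤ 1) (ha : a ∈ X) (hgap : ∀ p ∈ X, p ≤ a ∨ a + w ≤ p) (y : ℝ) :
    ∫⁻ lo, ∫⁻ hi, ind (hi - lo ∈ Ioc (2 * c * w) (w / 2)) *
      (∫⁻ x, ind (x ∈ Icc (a - c * w) a ∧ infDist (x + y - lo) X ≤ 4 * ρ) ∂μ) ∂μ ∂μ ≤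
    ENNReal.ofReal (C ^ 3 * w ^ δ) *
      ((∫⁻ u, ∫⁻ x, ind (x ∈ Icc (a - c * w) a ∧
        (σ < infDist (x + y - u) X ∧ infDist (x + y - u) X ≤ 4 * ρ)) ∂μ ∂μ) +
      ∫⁻ v, ∫⁻ q, ind (v + q - y ∈ Ioo a (a + w) ∧
        (σ < infDist (v + q - y) X ∧ infDist (v + q - y) X ≤ 4 * ρ)) ∂μ ∂μ) := by
  have hσ : 0 < σ := hα.trans_le hασ
  have hcw : c * w ≤ 1 / 12 * w := by gcongr
  have hDm : Measurable (fun z : ℝ × ℝ => ind (z.2 - z.1 ∈ Ioc (2 * c * w) (w / 2))) := by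
    have hm : Measurable fun z : ℝ × ℝ => z.2 - z.1 := by fun_prop
    exact measurable_ind (p := fun z : ℝ × ℝ => z.2 - z.1 ∈ Ioc (2 * c * w) (w / 2))
      (hm measurableSet_Ioc)
  have hdm : Measurable fun z : ℝ × ℝ => infDist (z.2 + y - z.1) X :=
    measurable_infDist_comp X (by fun_prop)
  have hIcc : MeasurableSet {z : ℝ × ℝ | z.2 ∈ Icc (a - c * w) a} :=
    measurable_snd measurableSet_Icc
  have hK₁ : Measurable fun z : ℝ × ℝ => ind (z.2 ∈ Icc (a - c * w) a ∧
        (σ < infDist (z.2 + y - z.1) X ∧ infDist (z.2 + y - z.1) X ≤ 4 * ρ)) :=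
    measurable_ind (hIcc.inter
      ((measurableSet_lt measurable_const hdm).inter (measurableSet_le hdm measurable_const)))
  have hK₂ : Measurable fun z : ℝ × ℝ => ind (z.2 ∈ Icc (a - c * w) a ∧
        infDist (z.2 + y - z.1) X ≤ σ) :=
    measurable_ind (hIcc.inter (measurableSet_le hdm measurable_const))
  have hPm : Measurable fun z : ℝ × ℝ => ind (z.1 + z.2 - y ∈ Ioo a (a + w) ∧
        (σ < infDist (z.1 + z.2 - y) X ∧ infDist (z.1 + z.2 - y) X ≤ 4 * ρ)) := by
    have hd : Measurable fun z : ℝ × ℝ => infDist (z.1 + z.2 - y) X :=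
      measurable_infDist_comp X (by fun_prop)
    have hm : Measurable fun z : ℝ × ℝ => z.1 + z.2 - y := by fun_prop
    exact measurable_ind ((hm measurableSet_Ioo).inter
      ((measurableSet_lt measurable_const hd).inter (measurableSet_le hd measurable_const)))
  set K₁ : ℝ → ℝ≥0∞ := fun u => ∫⁻ x, ind (x ∈ Icc (a - c * w) a ∧
        (σ < infDist (x + y - u) X ∧ infDist (x + y - u) X ≤ 4 * ρ)) ∂μ with hK₁def
  set K₂ : ℝ → ℝ≥0∞ := fun u => ∫⁻ x, ind (x ∈ Icc (a - c * w) a ∧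
        infDist (x + y - u) X ≤ σ) ∂μ with hK₂def
  set P : ℝ → ℝ≥0∞ := fun v => ∫⁻ q, ind (v + q - y ∈ Ioo a (a + w) ∧
        (σ < infDist (v + q - y) X ∧ infDist (v + q - y) X ≤ 4 * ρ)) ∂μ with hPdef
  have hK₁m : Measurable K₁ := hK₁.lintegral_prod_right'
  have hK₂m : Measurable K₂ := hK₂.lintegral_prod_right'
  have hPm' : Measurable P := hPm.lintegral_prod_right'
  have hDlo : ∀ lo, Measurable fun hi : ℝ => ind (hi - lo ∈ Ioc (2 * c * w) (w / 2)) :=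
    fun lo => hDm.comp (measurable_const.prodMk measurable_id)
  have hDhi : ∀ hi : ℝ, Measurable fun lo : ℝ => ind (hi - lo ∈ Ioc (2 * c * w) (w / 2)) :=
    fun hi => hDm.comp (measurable_id.prodMk measurable_const)
  have hball : ∀ t, μ (closedBall t (w / 2)) ≤ ENNReal.ofReal (C * (w / 2) ^ δ) := fun t =>
    hU t _ (by linarith) (by linarith)
  have hDlo' : ∀ lo, ∫⁻ hi, ind (hi - lo ∈ Ioc (2 * c * w) (w / 2)) ∂μ ≤
      ENNReal.ofReal (C * (w / 2) ^ δ) := fun lo => by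
    refine lintegral_ind_sub_le ?_ (fun x hx => ?_) (hball lo)
    · have hm : Measurable fun hi : ℝ => hi - lo := by fun_prop
      exact hm measurableSet_Ioc
    · exact abs_le.2 ⟨by nlinarith [hx.1], hx.2⟩
  have hDhi' : ∀ hi : ℝ, ∫⁻ lo, ind (hi - lo ∈ Ioc (2 * c * w) (w / 2)) ∂μ ≤
      ENNReal.ofReal (C * (w / 2) ^ δ) := fun hi => by
    refine lintegral_ind_sub_le ?_ (fun x hx => ?_) (hball hi)
    · have hm : Measurable fun lo : ℝ => hi - lo := by fun_prop
      exact hm measurableSet_Ioc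
    · rw [abs_sub_comm]
      exact abs_le.2 ⟨by nlinarith [hx.1], hx.2⟩
  have hw2 : (w / 2) ^ δ ≤ w ^ δ := Real.rpow_le_rpow (by positivity) (by linarith) hδ.le
  have h1 : ∫⁻ lo, ∫⁻ hi, ind (hi - lo ∈ Ioc (2 * c * w) (w / 2)) * K₁ lo ∂μ ∂μ ≤
      ENNReal.ofReal (C ^ 3 * w ^ δ) * ∫⁻ u, K₁ u ∂μ := by
    rw [← lintegral_const_mul _ hK₁m]
    refine lintegral_mono fun lo => ?_
    rw [lintegral_mul_const _ (hDlo lo)]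
    gcongr
    refine (hDlo' lo).trans (ENNReal.ofReal_le_ofReal ?_)
    have : C ≤ C ^ 3 := le_self_pow₀ hC.le (by norm_num)
    gcongr
  have h2 : ∫⁻ lo, ∫⁻ hi, ind (hi - lo ∈ Ioc (2 * c * w) (w / 2)) * K₂ lo ∂μ ∂μ ≤
      ENNReal.ofReal (C ^ 3 * w ^ δ) * ∫⁻ v, P v ∂μ := by
    set e : ℝ := C ^ 2 * 2 ^ δ with he
    have hpt : ∀ lo hi, ind (hi - lo ∈ Ioc (2 * c * w) (w / 2)) * K₂ lo ≤
        ENNReal.ofReal e * (ind (hi - lo ∈ Ioc (2 * c * w) (w / 2)) * P hi) := by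
      intro lo hi
      by_cases hD : hi - lo ∈ Ioc (2 * c * w) (w / 2)
      · rw [ind_of hD, one_mul, one_mul]
        have := shifted_gap_mass_le hα hXc hU hL hασ hσw hc' hw hwρ hρ ha hgap y lo hi hD
        rw [he, show C ^ 2 * 2 ^ δ = (C * (2 * σ) ^ δ) / (C⁻¹ * σ ^ δ) by
          rw [Real.mul_rpow (by norm_num) hσ.le]
          field_simp]
        exact ENNReal.le_ofReal_div_mul (by positivity) this
      · rw [ind_of_not hD]; simp
    have hDP : Measurable (fun z : ℝ × ℝ =>
        ind (z.2 - z.1 ∈ Ioc (2 * c * w) (w / 2)) * P z.2) :=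
      hDm.mul (hPm'.comp measurable_snd)
    calc ∫⁻ lo, ∫⁻ hi, ind (hi - lo ∈ Ioc (2 * c * w) (w / 2)) * K₂ lo ∂μ ∂μ
        ≤ ∫⁻ lo, ∫⁻ hi, ENNReal.ofReal e *
            (ind (hi - lo ∈ Ioc (2 * c * w) (w / 2)) * P hi) ∂μ ∂μ :=
          lintegral_mono fun lo => lintegral_mono fun hi => hpt lo hi
      _ = ENNReal.ofReal e * ∫⁻ lo, ∫⁻ hi,
            ind (hi - lo ∈ Ioc (2 * c * w) (w / 2)) * P hi ∂μ ∂μ := by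
          rw [← lintegral_const_mul _ hDP.lintegral_prod_right']
          congr 1 with lo
          exact lintegral_const_mul _ ((hDlo lo).mul hPm')
      _ = ENNReal.ofReal e * ∫⁻ hi, ∫⁻ lo,
            ind (hi - lo ∈ Ioc (2 * c * w) (w / 2)) * P hi ∂μ ∂μ := by
          rw [lintegral_lintegral_swap hDP.aemeasurable]
      _ ≤ ENNReal.ofReal e * ∫⁻ hi, ENNReal.ofReal (C * (w / 2) ^ δ) * P hi ∂μ := by
          gcongr with hi
          rw [lintegral_mul_const _ (hDhi hi)]
          gcongr
          exact hDhi' hi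
      _ = ENNReal.ofReal (C ^ 3 * w ^ δ) * ∫⁻ v, P v ∂μ := by
          rw [lintegral_const_mul _ hPm', ← mul_assoc, ← ENNReal.ofReal_mul (by positivity)]
          congr 2
          rw [he, Real.div_rpow hw.le (by norm_num)]
          field_simp
  rw [mul_add]
  refine le_trans ?_ (add_le_add h1 h2)
  have hDK₁ : Measurable (fun z : ℝ × ℝ =>
        ind (z.2 - z.1 ∈ Ioc (2 * c * w) (w / 2)) * K₁ z.1) :=
      hDm.mul (hK₁m.comp measurable_fst)
  rw [← lintegral_add_left hDK₁.lintegral_prod_right']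
  refine lintegral_mono fun lo => ?_
  refine le_of_le_of_eq ?_ (lintegral_add_left ((hDlo lo).mul_const (K₁ lo)) _)
  refine lintegral_mono fun hi => ?_
  rw [← mul_add]
  gcongr
  refine le_of_le_of_eq ?_
    (lintegral_add_left (hK₁.comp (measurable_const (a := lo) |>.prodMk measurable_id)) _)
  refine lintegral_mono fun x => ?_
  refine ind_le fun hx => ?_
  rcases le_or_gt (infDist (x + y - lo) X) σ with h | h
  · exact le_add_left (le_of_eq (ind_of ⟨hx.1, h⟩).symm)
  · exact le_add_right (le_of_eq (ind_of ⟨hx.1, h, hx.2⟩).symm)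

end GapEnergy

section Neighbours

variable {X : Set ℝ} {μ : Measure ℝ} {δ α C ρ σ c a w : ℝ}

theorem neighbour_energy_le [IsFiniteMeasure μ] (hδ : δ < 1) (hC : 1 < C)
    (hU : ∀ x r : ℝ, α ≤ r → r ≤ 1 → μ (closedBall x r) ≤ ENNReal.ofReal (C * r ^ δ))
    (hασ : α ≤ σ) (hσρ : σ ≤ ρ) (hσ : 0 < σ) (hc : 0 ≤ c) (hw : 0 < w) (hwρ : w ≤ ρ)
    (hρ : 2 * ρ ≤ 1) (y : ℝ) :
    ∫⁻ u, (∫⁻ x, ind (infDist (x + y - u) X ≤ σ) *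
        (∫⁻ q, ind (q ∈ Icc (a - c * w) a ∧ |q - x| ≤ 2 * ρ) ∂μ) ∂μ) *
      ((∫⁻ v, ind (v - u ∈ Ioc (2 * c * w) (w / 2)) ∂μ) +
        ∫⁻ v, ind (u - v ∈ Ioc (2 * c * w) (w / 2)) ∂μ) ∂μ ≤
    ENNReal.ofReal (4 * C * ρ ^ δ) *
      ∫⁻ lo, ∫⁻ hi, ind (hi - lo ∈ Ioc (2 * c * w) (w / 2)) *
        (∫⁻ x, ind (x ∈ Icc (a - c * w) a ∧ infDist (x + y - lo) X ≤ 4 * ρ) ∂μ) ∂μ ∂μ := by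
  have hρ0 : 0 < ρ := by linarith
  have hDm : Measurable (fun z : ℝ × ℝ => ind (z.2 - z.1 ∈ Ioc (2 * c * w) (w / 2))) := by
    have hm : Measurable fun z : ℝ × ℝ => z.2 - z.1 := by fun_prop
    exact measurable_ind (p := fun z : ℝ × ℝ => z.2 - z.1 ∈ Ioc (2 * c * w) (w / 2))
      (hm measurableSet_Ioc)
  have hDlo : ∀ lo, Measurable fun hi : ℝ => ind (hi - lo ∈ Ioc (2 * c * w) (w / 2)) :=
    fun lo => hDm.comp (measurable_const.prodMk measurable_id)
  have hDhi : ∀ hi : ℝ, Measurable fun lo : ℝ => ind (hi - lo ∈ Ioc (2 * c * w) (w / 2)) :=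
    fun hi => hDm.comp (measurable_id.prodMk measurable_const)
  have hKm : Measurable fun z : ℝ × ℝ => ind (z.2 ∈ Icc (a - c * w) a ∧
        infDist (z.2 + y - z.1) X ≤ 4 * ρ) :=
    measurable_ind ((measurable_snd measurableSet_Icc).inter (measurableSet_le
      (measurable_infDist_comp (β := ℝ × ℝ) X (f := fun z => z.2 + y - z.1) (by fun_prop))
      measurable_const))
  set K : ℝ → ℝ≥0∞ := fun lo =>
    ∫⁻ x, ind (x ∈ Icc (a - c * w) a ∧ infDist (x + y - lo) X ≤ 4 * ρ) ∂μ with hK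
  have hKm' : Measurable K := hKm.lintegral_prod_right'
  have hJ : ∀ u v, |v - u| ≤ w / 2 → ∫⁻ x, ind (infDist (x + y - u) X ≤ σ) *
        (∫⁻ q, ind (q ∈ Icc (a - c * w) a ∧ |q - x| ≤ 2 * ρ) ∂μ) ∂μ ≤
      ENNReal.ofReal (C * (2 * ρ) ^ δ) * K v := by
    intro u v huv
    have hE : Measurable fun x : ℝ => ind (infDist (x + y - u) X ≤ σ) :=
      measurable_ind (measurableSet_le (measurable_infDist_comp X (by fun_prop)) measurable_const)
    have hM : Measurable fun z : ℝ × ℝ => ind (z.2 ∈ Icc (a - c * w) a ∧ |z.2 - z.1| ≤ 2 * ρ) :=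
      measurable_ind ((measurable_snd measurableSet_Icc).inter (measurableSet_le
        (f := fun z : ℝ × ℝ => |z.2 - z.1|) (by fun_prop) measurable_const))
    have hB : Measurable fun z : ℝ × ℝ => ind (|z.2 - z.1| ≤ 2 * ρ) :=
      measurable_ind (p := fun z : ℝ × ℝ => |z.2 - z.1| ≤ 2 * ρ) (measurableSet_le
        (f := fun z : ℝ × ℝ => |z.2 - z.1|) (by fun_prop) measurable_const)
    calc ∫⁻ x, ind (infDist (x + y - u) X ≤ σ) *
          (∫⁻ q, ind (q ∈ Icc (a - c * w) a ∧ |q - x| ≤ 2 * ρ) ∂μ) ∂μ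
        = ∫⁻ x, ∫⁻ q, ind (infDist (x + y - u) X ≤ σ) *
            ind (q ∈ Icc (a - c * w) a ∧ |q - x| ≤ 2 * ρ) ∂μ ∂μ := by
          congr 1 with x
          exact (lintegral_const_mul _ (hM.comp (measurable_const.prodMk measurable_id))).symm
      _ = ∫⁻ q, ∫⁻ x, ind (infDist (x + y - u) X ≤ σ) *
            ind (q ∈ Icc (a - c * w) a ∧ |q - x| ≤ 2 * ρ) ∂μ ∂μ :=
          lintegral_lintegral_swap ((hE.comp measurable_fst).mul hM).aemeasurable
      _ ≤ ∫⁻ q, ENNReal.ofReal (C * (2 * ρ) ^ δ) *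
            ind (q ∈ Icc (a - c * w) a ∧ infDist (q + y - v) X ≤ 4 * ρ) ∂μ := by
          refine lintegral_mono fun q => ?_
          have hBq : MeasurableSet {x : ℝ | |x - q| ≤ 2 * ρ} :=
            measurableSet_le (by fun_prop) measurable_const
          refine le_trans ?_ (mul_le_mul_left (lintegral_ind_sub_le hBq (fun x hx => hx)
            (hU q _ (by linarith) hρ)) _)
          rw [← lintegral_mul_const _ (measurable_ind hBq)]
          refine lintegral_mono fun x => ?_
          by_cases hx : infDist (x + y - u) X ≤ σ
          · rw [ind_of hx, one_mul]
            refine ind_le fun hq => ?_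
            have h1 : infDist (q + y - v) X ≤ 4 * ρ := by
              refine infDist_le_infDist_add_dist (y := x + y - u) |>.trans ?_
              rw [Real.dist_eq]
              have h2 := abs_le.1 hq.2
              have h3 := abs_le.1 huv
              have h4 : |q + y - v - (x + y - u)| ≤ 2 * ρ + w / 2 :=
                abs_le.2 ⟨by linarith [h2.1, h3.2], by linarith [h2.2, h3.1]⟩
              linarith
            rw [ind_of (And.intro hq.1 h1), ind_of (by rw [abs_sub_comm]; exact hq.2), one_mul]
          · rw [ind_of_not hx, zero_mul]; exact zero_le
      _ = _ := lintegral_const_mul _ (hKm.comp (measurable_const.prodMk measurable_id))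
  have hDabs : ∀ t : ℝ, t ∈ Ioc (2 * c * w) (w / 2) → |t| ≤ w / 2 := fun t ht => by
    rw [abs_of_nonneg (le_trans (by positivity) ht.1.le)]
    exact ht.2
  have hDK₁ : Measurable (fun z : ℝ × ℝ =>
      ind (z.2 - z.1 ∈ Ioc (2 * c * w) (w / 2)) * K z.1) := hDm.mul (hKm'.comp measurable_fst)
  have hDK₂ : Measurable (fun z : ℝ × ℝ =>
      ind (z.1 - z.2 ∈ Ioc (2 * c * w) (w / 2)) * K z.2) := hDK₁.comp measurable_swap
  have hDK₁' : Measurable fun u =>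
      ∫⁻ v, ind (v - u ∈ Ioc (2 * c * w) (w / 2)) * K u ∂μ := hDK₁.lintegral_prod_right'
  have hDK₂' : Measurable fun u =>
      ∫⁻ v, ind (u - v ∈ Ioc (2 * c * w) (w / 2)) * K v ∂μ := hDK₂.lintegral_prod_right'
  calc _ ≤ ∫⁻ u, ENNReal.ofReal (C * (2 * ρ) ^ δ) *
        ((∫⁻ v, ind (v - u ∈ Ioc (2 * c * w) (w / 2)) * K u ∂μ) +
          ∫⁻ v, ind (u - v ∈ Ioc (2 * c * w) (w / 2)) * K v ∂μ) ∂μ := by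
        refine lintegral_mono fun u => ?_
        dsimp only
        rw [mul_add, mul_add]
        refine add_le_add ?_ ?_
        · rw [lintegral_mul_const _ (hDlo u), mul_comm _ (K u), ← mul_assoc]
          gcongr
          exact hJ u u (by rw [sub_self, abs_zero]; positivity)
        · have hDK : Measurable fun v => ind (u - v ∈ Ioc (2 * c * w) (w / 2)) * K v :=
            (hDhi u).mul hKm'
          rw [← lintegral_const_mul _ (hDhi u), ← lintegral_const_mul _ hDK]
          refine lintegral_mono fun v => ?_
          by_cases hD : u - v ∈ Ioc (2 * c * w) (w / 2)
          · rw [ind_of hD, one_mul, mul_one]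
            exact hJ u v (by rw [abs_sub_comm]; exact hDabs _ hD)
          · rw [ind_of_not hD, mul_zero]; exact zero_le
    _ = ENNReal.ofReal (C * (2 * ρ) ^ δ) *
        ((∫⁻ u, ∫⁻ v, ind (v - u ∈ Ioc (2 * c * w) (w / 2)) * K u ∂μ ∂μ) +
          ∫⁻ u, ∫⁻ v, ind (u - v ∈ Ioc (2 * c * w) (w / 2)) * K v ∂μ ∂μ) := by
        rw [← lintegral_add_left hDK₁']
        exact lintegral_const_mul _ (hDK₁'.add hDK₂')
    _ = ENNReal.ofReal (C * (2 * ρ) ^ δ) * (2 *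
        ∫⁻ u, ∫⁻ v, ind (v - u ∈ Ioc (2 * c * w) (w / 2)) * K u ∂μ ∂μ) := by
        congr 1
        refine Eq.trans (congrArg _ ?_) (two_mul _).symm
        exact lintegral_lintegral_swap (μ := μ) (ν := μ)
          (f := fun u v => ind (u - v ∈ Ioc (2 * c * w) (w / 2)) * K v) hDK₂.aemeasurable
    _ ≤ _ := by
        rw [← mul_assoc]
        gcongr
        rw [show (2 : ℝ≥0∞) = ENNReal.ofReal 2 by simp, ← ENNReal.ofReal_mul (by positivity)]
        refine ENNReal.ofReal_le_ofReal ?_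
        rw [Real.mul_rpow (by norm_num) hρ0.le]
        have h2 : (2 : ℝ) ^ δ ≤ 2 := by
          simpa using Real.rpow_le_rpow_of_exponent_le (x := 2) (by norm_num) hδ.le
        calc C * (2 ^ δ * ρ ^ δ) * 2 ≤ C * (2 * ρ ^ δ) * 2 := by gcongr
          _ = 4 * C * ρ ^ δ := by ring

theorem annulus_mass_ge (hδ' : δ < 1) (hC : 1 < C) (hδ : 0 < δ) (hα : 0 < α)
    (hU : ∀ x r : ℝ, α ≤ r → r ≤ 1 → μ (closedBall x r) ≤ ENNReal.ofReal (C * r ^ δ))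
    (hL : ∀ x ∈ X, ∀ r : ℝ, α ≤ r → r ≤ 1 →
      ENNReal.ofReal (C⁻¹ * r ^ δ) ≤ μ (closedBall x r))
    (hcδ : 4 * C ^ 2 * (4 * c) ^ δ = 1) (hc : 0 < c) (hc' : c ≤ 1 / 12) (hαw : α ≤ c * w)
    (hw : 0 < w) (hw' : w ≤ 1) {u : ℝ} (hu : u ∈ X) :
    ENNReal.ofReal (w ^ δ / (4 * C)) ≤ (∫⁻ v, ind (v - u ∈ Ioc (2 * c * w) (w / 2)) ∂μ) +
        ∫⁻ v, ind (u - v ∈ Ioc (2 * c * w) (w / 2)) ∂μ := by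
  have hcw : c * w ≤ 1 / 12 * w := by gcongr
  have hm₁ : MeasurableSet {v : ℝ | v - u ∈ Ioc (2 * c * w) (w / 2)} :=
    (show Measurable fun v : ℝ => v - u by fun_prop) measurableSet_Ioc
  have hm₂ : MeasurableSet {v : ℝ | u - v ∈ Ioc (2 * c * w) (w / 2)} :=
    (show Measurable fun v : ℝ => u - v by fun_prop) measurableSet_Ioc
  rw [lintegral_ind hm₁, lintegral_ind hm₂]
  have h1 := hL u hu (w / 2) (by linarith) (by linarith)
  have h2 := hU u (2 * c * w) (by linarith) (by linarith)
  have h3 : closedBall u (w / 2) ⊆ closedBall u (2 * c * w) ∪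
      ({v : ℝ | v - u ∈ Ioc (2 * c * w) (w / 2)} ∪ {v : ℝ | u - v ∈ Ioc (2 * c * w) (w / 2)}) := by
    intro v hv
    rw [mem_closedBall, Real.dist_eq] at hv
    by_cases h : |v - u| ≤ 2 * c * w
    · exact Or.inl (by rwa [mem_closedBall, Real.dist_eq])
    · right
      push Not at h
      rcases abs_cases (v - u) with h' | h'
      · exact Or.inl ⟨by linarith, by linarith⟩
      · exact Or.inr ⟨by linarith, by linarith⟩
  have h4 := (measure_mono h3).trans ((measure_union_le _ _).trans
    (add_le_add h2 (measure_union_le (μ := μ) _ _)))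
  have h5 : w ^ δ / (4 * C) + C * (2 * c * w) ^ δ ≤ C⁻¹ * (w / 2) ^ δ := by
    have e1 : (2 * c * w) ^ δ ≤ w ^ δ * (4 * c) ^ δ := by
      rw [← Real.mul_rpow hw.le (by positivity)]
      exact Real.rpow_le_rpow (by positivity) (by nlinarith [mul_pos hc hw]) hδ.le
    have e2 : w ^ δ / 2 ≤ (w / 2) ^ δ := by
      rw [Real.div_rpow hw.le (by norm_num)]
      gcongr
      simpa using Real.rpow_le_rpow_of_exponent_le (x := 2) (by norm_num) hδ'.le
    have e3 : (4 * c) ^ δ = 1 / (4 * C ^ 2) := by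
      rw [eq_div_iff (by positivity)]; linarith
    rw [e3] at e1
    calc w ^ δ / (4 * C) + C * (2 * c * w) ^ δ
        ≤ w ^ δ / (4 * C) + C * (w ^ δ * (1 / (4 * C ^ 2))) := by gcongr
      _ = C⁻¹ * (w ^ δ / 2) := by field_simp; ring
      _ ≤ _ := by gcongr
  have h6 := (ENNReal.ofReal_le_ofReal h5).trans (h1.trans h4)
  rw [ENNReal.ofReal_add (by positivity) (by positivity), add_comm] at h6
  exact (ENNReal.add_le_add_iff_left ENNReal.ofReal_ne_top).1 h6

theorem gap_edge_mass_ge (hδ' : δ < 1) (hC : 1 < C) (hμX : μ Xᶜ = 0)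
    (hL : ∀ x ∈ X, ∀ r : ℝ, α ≤ r → r ≤ 1 →
      ENNReal.ofReal (C⁻¹ * r ^ δ) ≤ μ (closedBall x r))
    (hcδ : 4 * C ^ 2 * (4 * c) ^ δ = 1) (hc : 0 < c) (hc' : c ≤ 1 / 12) (hαw : α ≤ c * w)
    (hw : 0 < w) (hwρ : w ≤ ρ) (hρ : 2 * ρ ≤ 1) (ha : a ∈ X)
    (hgap : ∀ p ∈ X, p ≤ a ∨ a + w ≤ p) {x : ℝ} (hx : a ∈ Icc x (x + ρ)) :
    ENNReal.ofReal (w ^ δ / (16 * C ^ 3)) ≤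
      ∫⁻ q, ind (q ∈ Icc (a - c * w) a ∧ |q - x| ≤ 2 * ρ) ∂μ := by
  have hcw : c * w ≤ 1 / 12 * w := by gcongr
  have hcw0 : 0 < c * w := by positivity
  rw [lintegral_ind (p := fun q => q ∈ Icc (a - c * w) a ∧ |q - x| ≤ 2 * ρ)
    (measurableSet_Icc.inter (measurableSet_le (f := fun q : ℝ => |q - x|)
      (by fun_prop) measurable_const))]
  have h1 : closedBall a (c * w) ⊆ {q | q ∈ Icc (a - c * w) a ∧ |q - x| ≤ 2 * ρ} ∪ Xᶜ := by
    intro q hq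
    by_cases hqX : q ∈ X
    · left
      rw [mem_closedBall, Real.dist_eq] at hq
      have hq' := abs_le.1 hq
      have hqa : q ≤ a := (hgap q hqX).resolve_right fun h => by linarith [hq'.2]
      exact ⟨⟨by linarith [hq'.1], hqa⟩, abs_le.2
        ⟨by linarith [hq'.1, hx.1], by linarith [hq'.2, hx.2]⟩⟩
    · exact Or.inr hqX
  have h2 := (measure_mono (μ := μ) h1).trans (measure_union_le _ _)
  rw [hμX, add_zero] at h2
  refine le_trans (ENNReal.ofReal_le_ofReal ?_)
    ((hL a ha (c * w) hαw (by linarith)).trans h2)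
  have e3 : (4 * c) ^ δ = 1 / (4 * C ^ 2) := by
    rw [eq_div_iff (by positivity)]; linarith
  have e4 : (4 * c) ^ δ ≤ 4 * c ^ δ := by
    rw [Real.mul_rpow (by norm_num) hc.le]
    gcongr
    simpa using Real.rpow_le_rpow_of_exponent_le (x := 4) (by norm_num) hδ'.le
  rw [e3] at e4
  have e5 : 1 / (16 * C ^ 2) ≤ c ^ δ := by
    have : 1 / (16 * C ^ 2) = 1 / (4 * C ^ 2) / 4 := by field_simp; norm_num
    linarith
  rw [Real.mul_rpow hc.le hw.le]
  calc w ^ δ / (16 * C ^ 3) = C⁻¹ * (1 / (16 * C ^ 2) * w ^ δ) := by field_simp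
    _ ≤ _ := by gcongr

end Neighbours

theorem sum_lintegral_ind_le {μ : Measure ℝ} [IsFiniteMeasure μ] {A : Finset ℝ}
    {Q : ℝ → ℝ → ℝ → Prop} {P : ℝ → ℝ → Prop}
    (hm : ∀ a, Measurable fun z : ℝ × ℝ => ind (Q a z.1 z.2))
    (hQP : ∀ a u x, Q a u x → P u x)
    (hd : ∀ a ∈ A, ∀ b ∈ A, a ≠ b → ∀ u x, Q a u x → ¬Q b u x) :
    ∑ a ∈ A, ∫⁻ u, ∫⁻ x, ind (Q a u x) ∂μ ∂μ ≤ ∫⁻ u, ∫⁻ x, ind (P u x) ∂μ ∂μ := by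
  rw [← lintegral_finsetSum _ fun a _ => (hm a).lintegral_prod_right']
  refine lintegral_mono fun u => ?_
  dsimp only
  have hm' : ∀ a, Measurable fun x => ind (Q a u x) := fun a =>
    (hm a).comp (measurable_const.prodMk measurable_id)
  rw [← lintegral_finsetSum _ fun a _ => hm' a]
  refine lintegral_mono fun x => ?_
  dsimp only
  by_cases h : ∃ a ∈ A, Q a u x
  · obtain ⟨a, ha, hax⟩ := h
    rw [Finset.sum_eq_single_of_mem a ha fun b hb hba =>
      ind_of_not (hd a ha b hb hba.symm u x hax)]
    exact ind_mono (hQP a u x)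
  · push Not at h
    rw [Finset.sum_eq_zero fun a ha => ind_of_not (h a ha)]
    exact zero_le

section Step

variable {X : Set ℝ} {μ : Measure ℝ} {δ α C ρ κ σ c : ℝ}
  {A : Finset ℝ} {w : ℝ → ℝ}

theorem gap_weight_ge (hδ : 0 < δ) (hδ' : δ < 1) (hC : 1 < C) (hα : 0 < α) (hμX : μ Xᶜ = 0)
    (hU : ∀ x r : ℝ, α ≤ r → r ≤ 1 → μ (closedBall x r) ≤ ENNReal.ofReal (C * r ^ δ))
    (hL : ∀ x ∈ X, ∀ r : ℝ, α ≤ r → r ≤ 1 →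
      ENNReal.ofReal (C⁻¹ * r ^ δ) ≤ μ (closedBall x r))
    (hcδ : 4 * C ^ 2 * (4 * c) ^ δ = 1) (hc : 0 < c) (hc' : c ≤ 1 / 12) (hκ : 0 < κ)
    (hακ : α ≤ c * κ) (hρ : 2 * ρ ≤ 1)
    (hA : ∀ a ∈ A, a ∈ X ∧ κ ≤ w a ∧ w a ≤ ρ ∧ ∀ p ∈ X, p ≤ a ∨ a + w a ≤ p)
    {x u : ℝ} (hu : u ∈ X) (hx : ρ / 4 ≤ ∑ a ∈ A with a ∈ Icc x (x + ρ), w a)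
    (hρ0 : 0 < ρ) :
    ENNReal.ofReal (ρ ^ δ / (256 * C ^ 4)) ≤ ∑ a ∈ A, ENNReal.ofReal (w a ^ (-δ)) *
      ((∫⁻ q, ind (q ∈ Icc (a - c * w a) a ∧ |q - x| ≤ 2 * ρ) ∂μ) *
        ((∫⁻ v, ind (v - u ∈ Ioc (2 * c * w a) (w a / 2)) ∂μ) +
          ∫⁻ v, ind (u - v ∈ Ioc (2 * c * w a) (w a / 2)) ∂μ)) := by
  refine le_trans ?_ (Finset.sum_le_sum_of_subset (Finset.filter_subset (· ∈ Icc x (x + ρ)) A))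
  have hpt : ∀ a ∈ A.filter (· ∈ Icc x (x + ρ)),
      ENNReal.ofReal (ρ ^ (δ - 1) / (64 * C ^ 4) * w a) ≤ ENNReal.ofReal (w a ^ (-δ)) *
      ((∫⁻ q, ind (q ∈ Icc (a - c * w a) a ∧ |q - x| ≤ 2 * ρ) ∂μ) *
        ((∫⁻ v, ind (v - u ∈ Ioc (2 * c * w a) (w a / 2)) ∂μ) +
          ∫⁻ v, ind (u - v ∈ Ioc (2 * c * w a) (w a / 2)) ∂μ)) := by
    intro a ha
    obtain ⟨haA, hax⟩ := Finset.mem_filter.1 ha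
    obtain ⟨haX, hκw, hwρ, hgap⟩ := hA a haA
    have hw : 0 < w a := hκ.trans_le hκw
    have hαw : α ≤ c * w a := hακ.trans (by gcongr)
    have h1 := annulus_mass_ge hδ' hC hδ hα hU hL hcδ hc hc' hαw hw (by linarith) hu
    have h2 := gap_edge_mass_ge hδ' hC hμX hL hcδ hc hc' hαw hw hwρ hρ haX hgap hax
    refine le_trans ?_ (mul_le_mul_right (mul_le_mul' h2 h1) _)
    rw [← ENNReal.ofReal_mul (by positivity), ← ENNReal.ofReal_mul (by positivity)]
    refine ENNReal.ofReal_le_ofReal ?_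
    have e1 : w a ^ (-δ) * w a ^ δ = 1 := by rw [← Real.rpow_add hw]; simp
    have e2 : w a ^ (δ - 1) * w a = w a ^ δ := by
      rw [← Real.rpow_add_one hw.ne']; simp
    have e3 : ρ ^ (δ - 1) ≤ w a ^ (δ - 1) :=
      Real.rpow_le_rpow_of_nonpos hw hwρ (by linarith)
    calc ρ ^ (δ - 1) / (64 * C ^ 4) * w a ≤ w a ^ (δ - 1) / (64 * C ^ 4) * w a := by gcongr
      _ = (w a ^ (δ - 1) * w a) / (64 * C ^ 4) := by ring
      _ = (w a ^ (-δ) * w a ^ δ) * w a ^ δ / (64 * C ^ 4) := by rw [e1, e2, one_mul]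
      _ = _ := by field_simp; norm_num
  refine le_trans ?_ (Finset.sum_le_sum hpt)
  have hw0 : ∀ a ∈ A.filter (· ∈ Icc x (x + ρ)), 0 ≤ w a := fun a ha =>
    hκ.le.trans (hA a (Finset.mem_filter.1 ha).1).2.1
  rw [← ENNReal.ofReal_sum_of_nonneg fun a ha => mul_nonneg (by positivity) (hw0 a ha),
    ← Finset.mul_sum]
  refine ENNReal.ofReal_le_ofReal ?_
  have e2 : ρ ^ (δ - 1) * ρ = ρ ^ δ := by
    rw [← Real.rpow_add_one hρ0.ne']; simp
  calc ρ ^ δ / (256 * C ^ 4) = ρ ^ (δ - 1) / (64 * C ^ 4) * (ρ / 4) := by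
        rw [← e2]; field_simp; norm_num
    _ ≤ _ := by gcongr

/-- For fixed `y`, the mass of the pairs `(u, x)` with `x + y - u` within `σ` of `X` is controlled
by the mass of the pairs for which the distance lies between `σ` and `4ρ`. -/
theorem pair_energy_step [IsFiniteMeasure μ] (hδ : 0 < δ) (hδ' : δ < 1) (hC : 1 < C) (hα : 0 < α)
    (hXc : IsClosed X) (hμX : μ Xᶜ = 0)
    (hU : ∀ x r : ℝ, α ≤ r → r ≤ 1 → μ (closedBall x r) ≤ ENNReal.ofReal (C * r ^ δ))
    (hL : ∀ x ∈ X, ∀ r : ℝ, α ≤ r → r ≤ 1 →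
      ENNReal.ofReal (C⁻¹ * r ^ δ) ≤ μ (closedBall x r))
    (hcδ : 4 * C ^ 2 * (4 * c) ^ δ = 1) (hc : 0 < c) (hc' : c ≤ 1 / 12) (hκ : 0 < κ)
    (hκρ : κ ≤ ρ) (hασ : α ≤ σ) (hσκ : 4 * σ ≤ c * κ) (hρ : 2 * ρ ≤ 1)
    (hA : ∀ a ∈ A, a ∈ X ∧ κ ≤ w a ∧ w a ≤ ρ ∧ ∀ p ∈ X, p ≤ a ∨ a + w a ≤ p)
    (hAd : ∀ a ∈ A, ∀ b ∈ A, a ≠ b →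
      Disjoint (Icc (a - c * w a) a) (Icc (b - c * w b) b))
    (hAX : ∀ x ∈ X, ρ / 4 ≤ ∑ a ∈ A with a ∈ Icc x (x + ρ), w a) (y : ℝ) :
    ∫⁻ u, ∫⁻ x, ind (infDist (x + y - u) X ≤ σ) ∂μ ∂μ ≤ ENNReal.ofReal (1024 * C ^ 8) *
      ((∫⁻ u, ∫⁻ x, ind (σ < infDist (x + y - u) X ∧ infDist (x + y - u) X ≤ 4 * ρ) ∂μ ∂μ) +
      ∫⁻ v, ∫⁻ q, ind (σ < infDist (v + q - y) X ∧ infDist (v + q - y) X ≤ 4 * ρ) ∂μ ∂μ) := by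
  have hσ : 0 < σ := hα.trans_le hασ
  have hρ0 : 0 < ρ := hκ.trans_le hκρ
  have hcκ : c * κ ≤ 1 / 12 * κ := by gcongr
  have hXae : ∀ᵐ x ∂μ, x ∈ X := by rw [ae_iff]; exact hμX
  have hdm : Measurable fun z : ℝ × ℝ => infDist (z.2 + y - z.1) X :=
    measurable_infDist_comp X (by fun_prop)
  have hEm : Measurable fun z : ℝ × ℝ => ind (infDist (z.2 + y - z.1) X ≤ σ) :=
    measurable_ind (measurableSet_le hdm measurable_const)
  have hEm' : ∀ u, Measurable fun x => ind (infDist (x + y - u) X ≤ σ) := fun u =>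
    measurable_ind (measurableSet_le (measurable_infDist_comp X (by fun_prop)) measurable_const)
  set H : ℝ → ℝ → ℝ≥0∞ := fun a x =>
    ∫⁻ q, ind (q ∈ Icc (a - c * w a) a ∧ |q - x| ≤ 2 * ρ) ∂μ with hH
  set m : ℝ → ℝ → ℝ≥0∞ := fun a u =>
    (∫⁻ v, ind (v - u ∈ Ioc (2 * c * w a) (w a / 2)) ∂μ) +
      ∫⁻ v, ind (u - v ∈ Ioc (2 * c * w a) (w a / 2)) ∂μ with hm
  have hHm : ∀ a, Measurable (H a) := fun a => by
    have : Measurable fun z : ℝ × ℝ =>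
        ind (z.2 ∈ Icc (a - c * w a) a ∧ |z.2 - z.1| ≤ 2 * ρ) :=
      measurable_ind ((measurable_snd measurableSet_Icc).inter (measurableSet_le
        (f := fun z : ℝ × ℝ => |z.2 - z.1|) (by fun_prop) measurable_const))
    exact this.lintegral_prod_right'
  have hmm : ∀ a, Measurable (m a) := fun a => by
    have h1 : Measurable fun z : ℝ × ℝ => ind (z.2 - z.1 ∈ Ioc (2 * c * w a) (w a / 2)) :=
      measurable_ind (p := fun z : ℝ × ℝ => z.2 - z.1 ∈ Ioc (2 * c * w a) (w a / 2))
        ((show Measurable fun z : ℝ × ℝ => z.2 - z.1 by fun_prop) measurableSet_Ioc)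
    exact h1.lintegral_prod_right'.add (h1.comp measurable_swap).lintegral_prod_right'
  set Λ := (∫⁻ u, ∫⁻ x, ind (σ < infDist (x + y - u) X ∧ infDist (x + y - u) X ≤ 4 * ρ) ∂μ ∂μ) +
      ∫⁻ v, ∫⁻ q, ind (σ < infDist (v + q - y) X ∧ infDist (v + q - y) X ≤ 4 * ρ) ∂μ ∂μ with hΛ
  have hsum₁ : ∑ a ∈ A, ∫⁻ u, ∫⁻ x, ind (x ∈ Icc (a - c * w a) a ∧
      (σ < infDist (x + y - u) X ∧ infDist (x + y - u) X ≤ 4 * ρ)) ∂μ ∂μ ≤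
      ∫⁻ u, ∫⁻ x, ind (σ < infDist (x + y - u) X ∧ infDist (x + y - u) X ≤ 4 * ρ) ∂μ ∂μ := by
    refine sum_lintegral_ind_le (fun a => ?_) (fun a u x h => h.2)
      fun a ha b hb hab u x h h' => ?_
    · exact measurable_ind ((measurable_snd measurableSet_Icc).inter
        ((measurableSet_lt measurable_const hdm).inter (measurableSet_le hdm measurable_const)))
    · exact Set.disjoint_left.1 (hAd a ha b hb hab) h.1 h'.1
  have hsum₂ : ∑ a ∈ A, ∫⁻ v, ∫⁻ q, ind (v + q - y ∈ Ioo a (a + w a) ∧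
      (σ < infDist (v + q - y) X ∧ infDist (v + q - y) X ≤ 4 * ρ)) ∂μ ∂μ ≤
      ∫⁻ v, ∫⁻ q, ind (σ < infDist (v + q - y) X ∧ infDist (v + q - y) X ≤ 4 * ρ) ∂μ ∂μ := by
    refine sum_lintegral_ind_le (fun a => ?_) (fun a u x h => h.2)
      fun a ha b hb hab u x h h' => ?_
    · have hd : Measurable fun z : ℝ × ℝ => infDist (z.1 + z.2 - y) X :=
        measurable_infDist_comp X (by fun_prop)
      exact measurable_ind (((show Measurable fun z : ℝ × ℝ => z.1 + z.2 - y by fun_prop)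
        measurableSet_Ioo).inter
        ((measurableSet_lt measurable_const hd).inter (measurableSet_le hd measurable_const)))
    · have h1 := h.1
      have h2 := h'.1
      rcases lt_or_gt_of_ne hab with hlt | hlt
      · have := ((hA a ha).2.2.2 b (hA b hb).1).resolve_left (not_le.2 hlt)
        linarith [h1.2, h2.1]
      · have := ((hA b hb).2.2.2 a (hA a ha).1).resolve_left (not_le.2 hlt)
        linarith [h1.1, h2.2]
  have hgap : ∀ a ∈ A, ENNReal.ofReal (w a ^ (-δ)) *
      ∫⁻ u, (∫⁻ x, ind (infDist (x + y - u) X ≤ σ) * H a x ∂μ) * m a u ∂μ ≤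
      ENNReal.ofReal (4 * C ^ 4 * ρ ^ δ) *
        ((∫⁻ u, ∫⁻ x, ind (x ∈ Icc (a - c * w a) a ∧
          (σ < infDist (x + y - u) X ∧ infDist (x + y - u) X ≤ 4 * ρ)) ∂μ ∂μ) +
        ∫⁻ v, ∫⁻ q, ind (v + q - y ∈ Ioo a (a + w a) ∧
          (σ < infDist (v + q - y) X ∧ infDist (v + q - y) X ≤ 4 * ρ)) ∂μ ∂μ) := by
    intro a ha
    obtain ⟨haX, hκw, hwρ, hgap⟩ := hA a ha
    have hw : 0 < w a := hκ.trans_le hκw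
    have hσw : 4 * σ ≤ c * w a := hσκ.trans (by gcongr)
    have h1 := neighbour_energy_le (X := X) (a := a) hδ' hC hU hασ (by linarith) hσ hc.le hw
      hwρ hρ y
    have h2 := gap_energy_le hC hα hXc hδ hU hL hασ hσw hc' hw hwρ hρ haX hgap y
    refine (mul_le_mul_right (h1.trans (mul_le_mul_right h2 _)) _).trans_eq ?_
    rw [← mul_assoc, ← mul_assoc, ← ENNReal.ofReal_mul (by positivity),
      ← ENNReal.ofReal_mul (by positivity)]
    congr 2
    have e1 : w a ^ (-δ) * w a ^ δ = 1 := by rw [← Real.rpow_add hw]; simp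
    linear_combination (4 * C ^ 4 * ρ ^ δ) * e1
  have hmain : ENNReal.ofReal (ρ ^ δ / (256 * C ^ 4)) *
      ∫⁻ u, ∫⁻ x, ind (infDist (x + y - u) X ≤ σ) ∂μ ∂μ ≤
      ENNReal.ofReal (4 * C ^ 4 * ρ ^ δ) * Λ := by
    calc _ = ∫⁻ u, ∫⁻ x, ENNReal.ofReal (ρ ^ δ / (256 * C ^ 4)) *
          ind (infDist (x + y - u) X ≤ σ) ∂μ ∂μ := by
          rw [← lintegral_const_mul _ hEm.lintegral_prod_right']
          congr 1 with u
          exact (lintegral_const_mul _ (hEm' u)).symm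
      _ ≤ ∫⁻ u, ∫⁻ x, ∑ a ∈ A, ENNReal.ofReal (w a ^ (-δ)) *
          (ind (infDist (x + y - u) X ≤ σ) * H a x * m a u) ∂μ ∂μ := by
          refine lintegral_mono_ae ?_
          filter_upwards [hXae] with u hu
          refine lintegral_mono_ae ?_
          filter_upwards [hXae] with x hx
          by_cases hE : infDist (x + y - u) X ≤ σ
          · simp only [ind_of hE, one_mul, mul_one]
            exact gap_weight_ge hδ hδ' hC hα hμX hU hL hcδ hc hc' hκ (by linarith) hρ hA hu
              (hAX x hx) hρ0
          · simp [ind_of_not hE]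
      _ = ∑ a ∈ A, ENNReal.ofReal (w a ^ (-δ)) *
          ∫⁻ u, (∫⁻ x, ind (infDist (x + y - u) X ≤ σ) * H a x ∂μ) * m a u ∂μ := by
          have hF : ∀ a, Measurable fun z : ℝ × ℝ =>
              ind (infDist (z.2 + y - z.1) X ≤ σ) * H a z.2 := fun a =>
            hEm.mul ((hHm a).comp measurable_snd)
          have hF' : ∀ a u, Measurable fun x => ind (infDist (x + y - u) X ≤ σ) * H a x :=
            fun a u => (hEm' u).mul (hHm a)
          calc _ = ∫⁻ u, ∑ a ∈ A, ENNReal.ofReal (w a ^ (-δ)) *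
                ((∫⁻ x, ind (infDist (x + y - u) X ≤ σ) * H a x ∂μ) * m a u) ∂μ := by
                congr 1 with u
                rw [lintegral_finsetSum _ fun a _ =>
                  ((hF' a u).mul_const _).const_mul _]
                refine Finset.sum_congr rfl fun a _ => ?_
                rw [lintegral_const_mul _ ((hF' a u).mul_const _),
                  lintegral_mul_const _ (hF' a u)]
            _ = _ := by
                have hG : ∀ a, Measurable fun u =>
                    (∫⁻ x, ind (infDist (x + y - u) X ≤ σ) * H a x ∂μ) * m a u := fun a =>
                  (hF a).lintegral_prod_right'.mul (hmm a)
                rw [lintegral_finsetSum _ fun a _ => (hG a).const_mul _]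
                exact Finset.sum_congr rfl fun a _ => lintegral_const_mul _ (hG a)
      _ ≤ _ := by
          refine (Finset.sum_le_sum hgap).trans ?_
          rw [← Finset.mul_sum, Finset.sum_add_distrib]
          gcongr
          exact add_le_add hsum₁ hsum₂
  refine (ENNReal.le_ofReal_div_mul (by positivity) hmain).trans_eq ?_
  congr 2
  field_simp
  norm_num

end Step

/-- The `μ³`-mass of the triples `(y, u, x)` with `x + y - u` within distance `s` of `X`. -/
noncomputable def tripleMass (X : Set ℝ) (μ : Measure ℝ) (s : ℝ) : ℝ≥0∞ :=
  ∫⁻ y, ∫⁻ u, ∫⁻ x, ind (infDist (x + y - u) X ≤ s) ∂μ ∂μ ∂μ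

section TripleMass

variable {X : Set ℝ} {μ : Measure ℝ} {δ α C ρ κ σ c : ℝ}

/-- Passing from scale `4ρ` to a sufficiently smaller scale decreases `tripleMass` by a fixed
factor. -/
theorem tripleMass_le_mul [IsFiniteMeasure μ] (hδ : 0 < δ) (hδ' : δ < 1) (hC : 1 < C) (hα : 0 < α)
    (hX : X ⊆ Icc 0 1) (hXc : IsClosed X) (hμX : μ Xᶜ = 0)
    (hU : ∀ x r : ℝ, α ≤ r → r ≤ 1 → μ (closedBall x r) ≤ ENNReal.ofReal (C * r ^ δ))
    (hL : ∀ x ∈ X, ∀ r : ℝ, α ≤ r → r ≤ 1 →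
      ENNReal.ofReal (C⁻¹ * r ^ δ) ≤ μ (closedBall x r))
    (hcδ : 4 * C ^ 2 * (4 * c) ^ δ = 1) (hc : 0 < c) (hc' : c ≤ 1 / 12) (hκ : 0 < κ)
    (hκρ : 2 * κ ≤ ρ) (hK : 16 * C ^ 2 * κ ^ (1 - δ) ≤ ρ ^ (1 - δ)) (hασ : α ≤ σ)
    (hσκ : 4 * σ ≤ c * κ) (hρ : 2 * ρ ≤ 1) :
    tripleMass X μ σ ≤
      ENNReal.ofReal (2048 * C ^ 8 / (1 + 2048 * C ^ 8)) * tripleMass X μ (4 * ρ) := by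
  have hσ : 0 < σ := hα.trans_le hασ
  have hcκ : c * κ ≤ 1 / 12 * κ := by gcongr
  obtain ⟨A, w, hA, hAd, hAX⟩ := exists_separated_gaps (c := c) hX hXc (by linarith) hκ hc.le hc'
    fun x hx => volume_infDist_le hδ' hC hα hXc hU hL (by linarith) hκρ hρ hK hx
  have hstep := pair_energy_step hδ hδ' hC hα hXc hμX hU hL hcδ hc hc' hκ (by linarith) hασ
    hσκ hρ hA hAd hAX
  have hdm : Measurable fun z : ℝ × ℝ × ℝ => infDist (z.2.2 + z.1 - z.2.1) X :=
    measurable_infDist_comp X (by fun_prop)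
  have hΛm : Measurable fun z : ℝ × ℝ × ℝ => ind (σ < infDist (z.2.2 + z.1 - z.2.1) X ∧
      infDist (z.2.2 + z.1 - z.2.1) X ≤ 4 * ρ) :=
    measurable_ind ((measurableSet_lt measurable_const hdm).inter
      (measurableSet_le hdm measurable_const))
  have hdm₂ : Measurable fun z : (ℝ × ℝ) × ℝ => infDist (z.2 + z.1.1 - z.1.2) X :=
    measurable_infDist_comp X (by fun_prop)
  have hΛm₂ : Measurable fun z : (ℝ × ℝ) × ℝ => ind (σ < infDist (z.2 + z.1.1 - z.1.2) X ∧
      infDist (z.2 + z.1.1 - z.1.2) X ≤ 4 * ρ) :=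
    measurable_ind ((measurableSet_lt measurable_const hdm₂).inter
      (measurableSet_le hdm₂ measurable_const))
  have hΛm₃ : Measurable fun z : ℝ × ℝ => ∫⁻ x, ind (σ < infDist (x + z.1 - z.2) X ∧
      infDist (x + z.1 - z.2) X ≤ 4 * ρ) ∂μ := hΛm₂.lintegral_prod_right'
  have hΛm₄ : Measurable fun y : ℝ => ∫⁻ u, ∫⁻ x, ind (σ < infDist (x + y - u) X ∧
      infDist (x + y - u) X ≤ 4 * ρ) ∂μ ∂μ := hΛm₃.lintegral_prod_right'
  have hΛm₅ : ∀ y : ℝ, Measurable fun u : ℝ => ∫⁻ x, ind (σ < infDist (x + y - u) X ∧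
      infDist (x + y - u) X ≤ 4 * ρ) ∂μ := fun y =>
    hΛm₃.comp (g := fun z : ℝ × ℝ => _) (f := fun u : ℝ => (y, u)) (by fun_prop)
  have hΛm₆ : ∀ y u : ℝ, Measurable fun x : ℝ => ind (σ < infDist (x + y - u) X ∧
      infDist (x + y - u) X ≤ 4 * ρ) := fun y u => by
    have hd : Measurable fun x : ℝ => infDist (x + y - u) X :=
      measurable_infDist_comp X (by fun_prop)
    exact measurable_ind ((measurableSet_lt measurable_const hd).inter
      (measurableSet_le hd measurable_const))
  set Λ := ∫⁻ y, ∫⁻ u, ∫⁻ x, ind (σ < infDist (x + y - u) X ∧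
      infDist (x + y - u) X ≤ 4 * ρ) ∂μ ∂μ ∂μ with hΛ
  have hsplit : Λ + tripleMass X μ σ = tripleMass X μ (4 * ρ) := by
    rw [hΛ, tripleMass, tripleMass, ← lintegral_add_left hΛm₄]
    congr 1 with y
    rw [← lintegral_add_left (hΛm₅ y)]
    congr 1 with u
    rw [← lintegral_add_left (hΛm₆ y u)]
    congr 1 with x
    rcases le_or_gt (infDist (x + y - u) X) σ with h | h
    · rw [ind_of h, ind_of_not (fun h' => not_lt.2 h h'.1), ind_of (by linarith), zero_add]
    · rw [ind_of_not (not_le.2 h), add_zero]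
      simp only [h, true_and]
  have hrelabel : ∫⁻ y, ∫⁻ v, ∫⁻ q, ind (σ < infDist (v + q - y) X ∧
      infDist (v + q - y) X ≤ 4 * ρ) ∂μ ∂μ ∂μ = Λ := by
    rw [hΛ, lintegral_lintegral_swap (f := fun y u => ∫⁻ x, ind (σ < infDist (x + y - u) X ∧
      infDist (x + y - u) X ≤ 4 * ρ) ∂μ) hΛm₃.aemeasurable]
    simp only [add_comm]
  have hle : tripleMass X μ σ ≤ ENNReal.ofReal (2048 * C ^ 8) * Λ := by
    refine (lintegral_mono hstep).trans ?_
    rw [lintegral_const_mul' _ _ ENNReal.ofReal_ne_top, lintegral_add_left hΛm₄, hrelabel,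
      ← two_mul, ← mul_assoc, show (2 : ℝ≥0∞) = ENNReal.ofReal 2 by simp,
      ← ENNReal.ofReal_mul (by positivity)]
    refine le_of_eq ?_
    congr 2
    ring
  refine ENNReal.le_ofReal_div_mul (by positivity) ?_
  rw [ENNReal.ofReal_add zero_le_one (by positivity), ENNReal.ofReal_one, add_mul, one_mul,
    ← hsplit, mul_add]
  gcongr

theorem tripleMass_iterate {q θ : ℝ} (hq : 0 < q) (hq1 : q ≤ 1)
    (hstep : ∀ s, s ≤ 2 → α ≤ q * s →
      tripleMass X μ (q * s) ≤ ENNReal.ofReal θ * tripleMass X μ s)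
    {s : ℝ} (hs : 0 ≤ s) (hs' : s ≤ 2) (n : ℕ) (hn : α ≤ q ^ n * s) :
    tripleMass X μ (q ^ n * s) ≤ ENNReal.ofReal θ ^ n * tripleMass X μ s := by
  induction n with
  | zero => simp
  | succ n ih =>
    have h0 : q ^ n * s ≤ s := mul_le_of_le_one_left hs (pow_le_one₀ hq.le hq1)
    have h1 : q ^ (n + 1) * s = q * (q ^ n * s) := by ring
    have h2 : q * (q ^ n * s) ≤ q ^ n * s := mul_le_of_le_one_left (by positivity) hq1
    rw [h1] at hn ⊢
    refine (hstep _ (h0.trans hs') hn).trans ?_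
    rw [pow_succ', mul_assoc]
    gcongr
    exact ih (hn.trans h2)

theorem tripleMass_mono {s t : ℝ} (h : s ≤ t) : tripleMass X μ s ≤ tripleMass X μ t :=
  lintegral_mono fun _ => lintegral_mono fun _ => lintegral_mono fun _ =>
    ind_mono fun h' => h'.trans h

theorem tripleMass_eq (X : Set ℝ) (μ : Measure ℝ) [IsFiniteMeasure μ] (s : ℝ) :
    tripleMass X μ s = ∫⁻ y, ∫⁻ x, ∫⁻ u, ind (infDist (y + x - u) X ≤ s) ∂μ ∂μ ∂μ := by
  rw [tripleMass]
  congr 1 with y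
  have hm : Measurable fun z : ℝ × ℝ => ind (infDist (z.2 + y - z.1) X ≤ s) :=
    measurable_ind (measurableSet_le (measurable_infDist_comp (β := ℝ × ℝ) X
      (f := fun z => z.2 + y - z.1) (by fun_prop)) measurable_const)
  rw [lintegral_lintegral_swap (f := fun u x => ind (infDist (x + y - u) X ≤ s)) hm.aemeasurable]
  simp only [add_comm]

theorem addEnergy_eq_lintegral (μ : Measure ℝ) [IsFiniteMeasure μ] (r : ℝ) :
    addEnergy μ r = ∫⁻ y, ∫⁻ x, ∫⁻ u, μ (closedBall (y + x - u) r) ∂μ ∂μ ∂μ := by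
  have h1 : MeasurableSet {p : ℝ × ℝ × ℝ × ℝ | ‖p.1 + p.2.1 - p.2.2.1 - p.2.2.2‖ ≤ r} :=
    measurableSet_le (by fun_prop) measurable_const
  rw [addEnergy, Measure.prod_apply h1]
  congr 1 with y
  have h2 := measurable_prodMk_left (x := y) h1
  rw [Measure.prod_apply h2]
  congr 1 with x
  have h3 := measurable_prodMk_left (x := x) h2
  rw [Measure.prod_apply h3]
  congr 1 with u
  congr 1 with v
  rw [mem_closedBall, Real.dist_eq, abs_sub_comm]
  rfl

theorem addEnergy_le_tripleMass [IsFiniteMeasure μ] (hμX : μ Xᶜ = 0) {b r : ℝ}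
    (hU : ∀ x, μ (closedBall x r) ≤ ENNReal.ofReal b) :
    addEnergy μ r ≤ ENNReal.ofReal b * tripleMass X μ r := by
  have hne := ENNReal.ofReal_ne_top (r := b)
  rw [addEnergy_eq_lintegral, tripleMass_eq, ← lintegral_const_mul' _ _ hne]
  refine lintegral_mono fun y => ?_
  dsimp only
  rw [← lintegral_const_mul' _ _ hne]
  refine lintegral_mono fun x => ?_
  dsimp only
  rw [← lintegral_const_mul' _ _ hne]
  refine lintegral_mono fun u => ?_
  by_cases h : infDist (y + x - u) X ≤ r
  · rw [ind_of h, mul_one]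
    exact hU _
  · rw [ind_of_not h, mul_zero, nonpos_iff_eq_zero]
    refine measure_mono_null (t := Xᶜ) (fun p hp hpX => h ?_) hμX
    rw [mem_closedBall, dist_comm] at hp
    exact (infDist_le_dist_of_mem hpX).trans hp

theorem tripleMass_le_addEnergy [IsFiniteMeasure μ] (hXc : IsClosed X) (hne : X.Nonempty) {b r : ℝ}
    (hL : ∀ x ∈ X, ENNReal.ofReal b ≤ μ (closedBall x (r / 2))) :
    ENNReal.ofReal b * tripleMass X μ (r / 2) ≤ addEnergy μ r := by
  have htop := ENNReal.ofReal_ne_top (r := b)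
  rw [addEnergy_eq_lintegral, tripleMass_eq, ← lintegral_const_mul' _ _ htop]
  refine lintegral_mono fun y => ?_
  dsimp only
  rw [← lintegral_const_mul' _ _ htop]
  refine lintegral_mono fun x => ?_
  dsimp only
  rw [← lintegral_const_mul' _ _ htop]
  refine lintegral_mono fun u => ?_
  by_cases h : infDist (y + x - u) X ≤ r / 2
  · obtain ⟨p, hp, hpd⟩ := exists_mem_dist_le hXc hne h
    rw [ind_of h, mul_one]
    refine (hL p hp).trans (measure_mono (closedBall_subset_closedBall' ?_))
    rw [dist_comm, Real.dist_eq]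
    linarith
  · rw [ind_of_not h, mul_zero]
    exact zero_le

end TripleMass

/-- The ratio between consecutive scales in the iteration. -/
noncomputable def scaleRatio (δ C : ℝ) : ℝ :=
  Real.exp (-(Real.log 64 + Real.log (4 * C ^ 2) / δ + Real.log (16 * C ^ 2) / (1 - δ)))

theorem tripleMass_scaleRatio_le {X : Set ℝ} {μ : Measure ℝ} [IsFiniteMeasure μ] {δ α C s : ℝ}
    (hδ : 0 < δ) (hδ' : δ < 1) (hC : 1 < C) (hα : 0 < α)
    (hX : X ⊆ Icc 0 1) (hXc : IsClosed X) (hμX : μ Xᶜ = 0)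
    (hU : ∀ x r : ℝ, α ≤ r → r ≤ 1 → μ (closedBall x r) ≤ ENNReal.ofReal (C * r ^ δ))
    (hL : ∀ x ∈ X, ∀ r : ℝ, α ≤ r → r ≤ 1 →
      ENNReal.ofReal (C⁻¹ * r ^ δ) ≤ μ (closedBall x r))
    (hs : s ≤ 2) (hαs : α ≤ scaleRatio δ C * s) :
    tripleMass X μ (scaleRatio δ C * s) ≤
      ENNReal.ofReal (2048 * C ^ 8 / (1 + 2048 * C ^ 8)) * tripleMass X μ s := by
  have hδ1 : 0 < 1 - δ := by linarith
  have hC2 : 1 < C ^ 2 := one_lt_pow₀ hC (by norm_num)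
  set c := Real.exp (-(Real.log (4 * C ^ 2) / δ)) / 4 with hc
  set K := Real.exp (Real.log (16 * C ^ 2) / (1 - δ)) with hK
  have hc0 : 0 < c := by positivity
  have hK0 : 0 < K := Real.exp_pos _
  have hs0 : 0 < s := by
    have := hα.trans_le hαs
    exact pos_of_mul_pos_right this (Real.exp_pos _).le
  have hratio : scaleRatio δ C = c / (16 * K) := by
    rw [scaleRatio, neg_add, neg_add, Real.exp_add, Real.exp_add, Real.exp_neg (Real.log 64),
      Real.exp_log (by norm_num), Real.exp_neg (Real.log (16 * C ^ 2) / _), ← hK, hc]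
    field_simp
    norm_num
  have hcδ : 4 * C ^ 2 * (4 * c) ^ δ = 1 := by
    rw [hc, mul_div_cancel₀ _ (by norm_num), ← Real.exp_mul, neg_mul,
      div_mul_cancel₀ _ hδ.ne', Real.exp_neg, Real.exp_log (by positivity)]
    field_simp
  have hKδ : K ^ (1 - δ) = 16 * C ^ 2 := by
    rw [hK, ← Real.exp_mul, div_mul_cancel₀ _ hδ1.ne', Real.exp_log (by positivity)]
  have hK2 : 2 ≤ K := by
    have h0 : 0 ≤ Real.log (16 * C ^ 2) := Real.log_nonneg (by linarith)
    have h1 : Real.log (16 * C ^ 2) ≤ Real.log (16 * C ^ 2) / (1 - δ) :=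
      le_div_self h0 hδ1 (by linarith)
    have h2 := Real.exp_le_exp.2 h1
    rw [Real.exp_log (by positivity)] at h2
    linarith
  have hc' : c ≤ 1 / 12 := by
    have h0 : 0 ≤ Real.log (4 * C ^ 2) := Real.log_nonneg (by linarith)
    have h1 : Real.log (4 * C ^ 2) ≤ Real.log (4 * C ^ 2) / δ := le_div_self h0 hδ hδ'.le
    have h2 := Real.exp_le_exp.2 h1
    rw [Real.exp_log (by positivity)] at h2
    have h3 : Real.exp (-(Real.log (4 * C ^ 2) / δ)) ≤ 1 / 3 := by
      rw [Real.exp_neg, inv_eq_one_div]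
      exact one_div_le_one_div_of_le (by norm_num) (by linarith)
    rw [hc]
    linarith
  have h4 : 4 * (s / 4) = s := by ring
  rw [← h4, hratio]
  rw [hratio] at hαs
  refine tripleMass_le_mul (κ := s / (4 * K)) hδ hδ' hC hα hX hXc hμX hU hL hcδ hc0 hc'
    (by positivity) ?_ ?_ (by rwa [h4]) ?_ (by linarith)
  · rw [show 2 * (s / (4 * K)) = s / 4 * (2 / K) by field_simp]
    exact mul_le_of_le_one_right (by positivity) ((div_le_one hK0).2 hK2)
  · rw [← div_div, Real.div_rpow (by positivity) hK0.le, hKδ]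
    field_simp
    rfl
  · refine le_of_eq ?_
    field_simp
    norm_num

theorem exists_iterate_count {δ C ε : ℝ} (hδ : 0 < δ) (hδ' : δ < 1) (hC : 1 < C) (hε : 0 < ε)
    (hε' : ε ≤ 1 / 2) :
    ∃ n : ℕ, (2048 * C ^ 8 / (1 + 2048 * C ^ 8)) ^ n ≤ ε ∧
      Real.exp (-(20000 * C ^ (16 : ℝ) * Real.log (C / ε) ^ 2 / (ε ^ 2 * min δ (1 - δ)))) ≤
        scaleRatio δ C ^ n / 2 := by
  have hδ1 : 0 < 1 - δ := by linarith
  set m := min δ (1 - δ) with hm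
  have hm0 : 0 < m := lt_min hδ hδ1
  have hm1 : m ≤ 1 / 2 := by
    rcases le_total δ (1 / 2) with h | h
    · exact (min_le_left _ _).trans h
    · exact (min_le_right _ _).trans (by linarith)
  set L := Real.log (C / ε) with hL
  have hlC : 0 < Real.log C := Real.log_pos hC
  have hLeq : L = Real.log C - Real.log ε := Real.log_div (by positivity) hε.ne'
  have hlε : Real.log ε ≤ -Real.log 2 := by
    rw [← Real.log_inv]
    exact Real.log_le_log hε (by linarith)
  have hl2 : 1 / 2 < Real.log 2 := by linarith [Real.log_two_gt_d9]
  have hl2' : Real.log 2 < 1 := by linarith [Real.log_two_lt_d9]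
  have hl64 : Real.log 64 = 6 * Real.log 2 := by
    rw [show (64 : ℝ) = 2 ^ 6 by norm_num, Real.log_pow]; norm_num
  have hl4 : Real.log (4 * C ^ 2) = 2 * Real.log 2 + 2 * Real.log C := by
    rw [Real.log_mul (by norm_num) (by positivity), show (4 : ℝ) = 2 ^ 2 by norm_num,
      Real.log_pow, Real.log_pow]; norm_num
  have hl16 : Real.log (16 * C ^ 2) = 4 * Real.log 2 + 2 * Real.log C := by
    rw [Real.log_mul (by norm_num) (by positivity), show (16 : ℝ) = 2 ^ 4 by norm_num,
      Real.log_pow, Real.log_pow]; norm_num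
  have hL0 : 0 < L := by linarith
  have hC8 : 1 ≤ C ^ 8 := one_le_pow₀ hC.le
  set N := 2048 * C ^ 8 with hN
  have hN0 : 0 < N := by positivity
  have hT : Real.log 64 + Real.log (4 * C ^ 2) / δ + Real.log (16 * C ^ 2) / (1 - δ) ≤
      9 * L / m := by
    have h1 : Real.log (4 * C ^ 2) / δ ≤ 2 * L / m :=
      div_le_div₀ (by positivity) (by linarith) hm0 (min_le_left _ _)
    have h2 : Real.log (16 * C ^ 2) / (1 - δ) ≤ 4 * L / m :=
      div_le_div₀ (by positivity) (by linarith) hm0 (min_le_right _ _)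
    have h3 : Real.log 64 ≤ 3 * L / m := by
      rw [le_div_iff₀ hm0, hl64]
      nlinarith
    calc _ ≤ 3 * L / m + 2 * L / m + 4 * L / m := by linarith
      _ = _ := by ring
  refine ⟨⌈(1 + N) * L⌉₊, ?_, ?_⟩
  · have h1 : N / (1 + N) ≤ Real.exp (-(1 / (1 + N))) := by
      have := Real.add_one_le_exp (-(1 / (1 + N)))
      refine le_trans (le_of_eq ?_) this
      field_simp
      ring
    have h2 : (1 + N) * L ≤ ⌈(1 + N) * L⌉₊ := Nat.le_ceil _
    calc (N / (1 + N)) ^ ⌈(1 + N) * L⌉₊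
        ≤ Real.exp (-(1 / (1 + N))) ^ ⌈(1 + N) * L⌉₊ := by gcongr
      _ = Real.exp (⌈(1 + N) * L⌉₊ * -(1 / (1 + N))) := (Real.exp_nat_mul _ _).symm
      _ ≤ Real.exp (Real.log ε) := by
          refine Real.exp_le_exp.2 ?_
          have h3 : L ≤ ⌈(1 + N) * L⌉₊ * (1 / (1 + N)) := by
            rw [mul_one_div, le_div_iff₀ (by positivity), mul_comm]
            exact h2
          linarith
      _ = ε := Real.exp_log hε
  · have h1 : (⌈(1 + N) * L⌉₊ : ℝ) ≤ 2051 * C ^ 8 * L := by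
      have := (Nat.ceil_lt_add_one (a := (1 + N) * L) (by positivity)).le
      have h2 : L ≤ C ^ 8 * L := le_mul_of_one_le_left hL0.le hC8
      calc _ ≤ (1 + N) * L + 1 := this
        _ = 2048 * (C ^ 8 * L) + L + 1 := by rw [hN]; ring
        _ ≤ 2048 * (C ^ 8 * L) + C ^ 8 * L + 2 * (C ^ 8 * L) := by linarith
        _ = _ := by ring
    rw [scaleRatio, ← Real.exp_nat_mul, show (2 : ℝ) = Real.exp (Real.log 2) from
      (Real.exp_log (by norm_num)).symm, ← Real.exp_sub]
    refine Real.exp_le_exp.2 ?_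
    set T := Real.log 64 + Real.log (4 * C ^ 2) / δ + Real.log (16 * C ^ 2) / (1 - δ)
    have h2 : (⌈(1 + N) * L⌉₊ : ℝ) * T ≤ 2051 * C ^ 8 * L * (9 * L / m) :=
      (mul_le_mul_of_nonneg_left hT (Nat.cast_nonneg _)).trans
        (mul_le_mul_of_nonneg_right h1 (by positivity))
    have h3 : Real.log 2 ≤ C ^ 8 * L ^ 2 / m := by
      rw [le_div_iff₀ hm0]
      have : 1 / 4 ≤ L ^ 2 := by nlinarith
      nlinarith
    have h4 : 2051 * C ^ 8 * L * (9 * L / m) + C ^ 8 * L ^ 2 / m ≤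
        20000 * C ^ (16 : ℝ) * L ^ 2 / (ε ^ 2 * m) := by
      have e1 : C ^ (16 : ℝ) = C ^ 16 := by exact_mod_cast Real.rpow_natCast C 16
      have e2 : C ^ 8 ≤ C ^ 16 := pow_le_pow_right₀ hC.le (by norm_num)
      have e3 : ε ^ 2 * m ≤ m := mul_le_of_le_one_left hm0.le (pow_le_one₀ hε.le (by linarith))
      rw [e1]
      calc _ = 18460 * C ^ 8 * L ^ 2 / m := by ring
        _ ≤ 20000 * C ^ 16 * L ^ 2 / m := by gcongr; norm_num
        _ ≤ _ := by gcongr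
    linarith

/-- **Energy at nearby scales.** There are absolute constants `C₂, A > 0` such that,
setting `r₀ = exp(-C₂ C¹⁶ (log(C/ε))² / (ε² min(δ,1-δ)))`, every `δ`-regular set
`X ⊆ [0,1]` on scales `[α,1]` with constant `C` and associated regular measure `μ`
satisfies `E(μ, r) ≤ A C⁴ ε r₀^δ E(μ, r/r₀)` for all `α ≤ r ≤ r₀`. -/
theorem energy_nearby_scales :
    ∃ C₂ A : ℝ, 0 < C₂ ∧ 0 < A ∧
      ∀ (δ C α ε : ℝ), 0 < δ → δ < 1 → 1 < C → 0 < α → α < 1 → 0 < ε → ε ≤ 1 / 2 →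
        ∀ (X : Set ℝ) (μ : Measure ℝ),
          X ⊆ Set.Icc 0 1 → IsClosed X → X.Nonempty →
          IsRegularMeasure δ α 1 C X μ →
          ∀ r : ℝ, α ≤ r →
            r ≤ Real.exp (-(C₂ * C ^ (16 : ℝ) * Real.log (C / ε) ^ 2 /
              (ε ^ 2 * min δ (1 - δ)))) →
            addEnergy μ r ≤
              ENNReal.ofReal (A * C ^ 4 * ε *
                  Real.exp (-(C₂ * C ^ (16 : ℝ) * Real.log (C / ε) ^ 2 /
                    (ε ^ 2 * min δ (1 - δ)))) ^ δ) *
                addEnergy μ (r / Real.exp (-(C₂ * C ^ (16 : ℝ) * Real.log (C / ε) ^ 2 /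
                  (ε ^ 2 * min δ (1 - δ))))) := by
  refine ⟨20000, 2, by norm_num, by norm_num, ?_⟩
  intro δ C α ε hδ hδ' hC hα hα' hε hε' X μ hX hXc hne hμ r hαr hr
  obtain ⟨hfin, hμX, hU, hL⟩ := hμ
  have : IsFiniteMeasure μ := by
    refine ⟨?_⟩
    rw [← union_compl_self X]
    refine (measure_union_le _ _).trans_lt ?_
    rw [hμX, add_zero]
    exact hfin X (isCompact_Icc.of_isClosed_subset hXc hX)
  obtain ⟨n, hnε, hnr⟩ := exists_iterate_count hδ hδ' hC hε hε'
  set r₀ := Real.exp (-(20000 * C ^ (16 : ℝ) * Real.log (C / ε) ^ 2 / (ε ^ 2 * min δ (1 - δ))))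
  set q := scaleRatio δ C with hq
  set R := r / r₀ with hR
  have hr₀ : 0 < r₀ := Real.exp_pos _
  have hr0 : 0 < r := hα.trans_le hαr
  have hR0 : 0 < R := by positivity
  have hR1 : R ≤ 1 := (div_le_one hr₀).2 hr
  have hq0 : 0 < q := Real.exp_pos _
  have hq1 : q ≤ 1 := by
    have h1 : 0 ≤ Real.log (4 * C ^ 2) := Real.log_nonneg (by nlinarith)
    have h2 : 0 ≤ Real.log (16 * C ^ 2) := Real.log_nonneg (by nlinarith)
    have h3 : 0 < 1 - δ := by linarith
    rw [hq, scaleRatio, Real.exp_le_one_iff, neg_nonpos]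
    positivity
  have hrR : r = r₀ * R := (mul_div_cancel₀ _ hr₀.ne').symm
  have hrn : r ≤ q ^ n * (R / 2) := by
    rw [hrR]
    calc r₀ * R ≤ q ^ n / 2 * R := by gcongr
      _ = _ := by ring
  have hrR2 : r ≤ R / 2 := hrn.trans
    (mul_le_of_le_one_left (by positivity) (pow_le_one₀ hq0.le hq1))
  have hmass : tripleMass X μ r ≤ ENNReal.ofReal ε * tripleMass X μ (R / 2) := by
    refine (tripleMass_mono hrn).trans ?_
    refine (tripleMass_iterate (α := α) hq0 hq1 (fun s hs hαs =>
      tripleMass_scaleRatio_le hδ hδ' hC hα hX hXc hμX hU hL hs hαs) (by positivity) (by linarith) n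
      (hαr.trans hrn)).trans ?_
    rw [← ENNReal.ofReal_pow (by positivity)]
    gcongr
  have hupper : addEnergy μ r ≤ ENNReal.ofReal (C * r ^ δ) * tripleMass X μ r :=
    addEnergy_le_tripleMass hμX fun x => hU x r hαr (by linarith)
  have hlower : ENNReal.ofReal (C⁻¹ * (R / 2) ^ δ) * tripleMass X μ (R / 2) ≤ addEnergy μ R :=
    tripleMass_le_addEnergy hXc hne fun x hx => hL x hx _ (hαr.trans hrR2) (by linarith)
  have hlower' := ENNReal.le_ofReal_div_mul (a := C⁻¹ * (R / 2) ^ δ) (b := 1)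
    (by positivity) (hlower.trans_eq (by rw [ENNReal.ofReal_one, one_mul]))
  refine hupper.trans ((mul_le_mul_right (hmass.trans (mul_le_mul_right hlower' _)) _).trans ?_)
  rw [← mul_assoc, ← mul_assoc, ← ENNReal.ofReal_mul (by positivity),
    ← ENNReal.ofReal_mul (by positivity)]
  refine mul_le_mul_left (ENNReal.ofReal_le_ofReal ?_) _
  have e1 : (2 : ℝ) ^ δ ≤ 2 := by
    simpa using Real.rpow_le_rpow_of_exponent_le (x := 2) (by norm_num) hδ'.le
  have e2 : C ^ 2 ≤ C ^ 4 := pow_le_pow_right₀ hC.le (by norm_num)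
  have e3 : r ^ δ = r₀ ^ δ * R ^ δ := by rw [← Real.mul_rpow hr₀.le hR0.le, ← hrR]
  rw [e3, Real.div_rpow hR0.le (by norm_num)]
  calc C * (r₀ ^ δ * R ^ δ) * ε * (1 / (C⁻¹ * (R ^ δ / 2 ^ δ)))
      = 2 ^ δ * C ^ 2 * ε * r₀ ^ δ := by field_simp
    _ ≤ 2 * C ^ 4 * ε * r₀ ^ δ := by gcongr
end
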